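/- arXiv:2405.12684 — 5 statements merged into one kernel-verified Lean document; each statement's English description precedes it below -/
import Mathlib

section
/- Under the bounded support assumption, for every T > 0 the law of Y_T satisfies KL( law(Y_T) | N(0, I_d) ) ≤ (1/2) [ e^{-2T} E‖Y₀‖² − d log(1 − e^{-2T}) − d e^{-2T} ]. -/
open MeasureTheory Real ProbabilityTheory

/-- The standard Gaussian measure `N(0, I_d)` on `ℝ^d`. -/
noncomputable def stdGaussian (d : ℕ) : Measure (EuclideanSpace ℝ (Fin d)) :=
  volume.withDensity fun y =>
    ENNReal.ofReal ((2 * π) ^ (-(d : ℝ) / 2) * Real.exp (-‖y‖ ^ 2 / 2))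

/-- Kullback–Leibler divergence `KL(μ | ν) = ∫ log(dμ/dν) dμ`. -/
noncomputable def KLdiv {d : ℕ} (μ ν : Measure (EuclideanSpace ℝ (Fin d))) : ℝ :=
  ∫ x, Real.log (μ.rnDeriv ν x).toReal ∂μ

open InformationTheory

theorem stdGaussian_eq_probabilityTheory_stdGaussian (d : ℕ) (h : IsProbabilityMeasure (_root_.stdGaussian d)) :
    _root_.stdGaussian d = ProbabilityTheory.stdGaussian (EuclideanSpace ℝ (Fin d)) := by
  apply Measure.ext_of_charFun
  ext t
  rw [charFun_stdGaussian, charFun_apply, _root_.stdGaussian,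
    integral_withDensity_eq_integral_toReal_smul (by fun_prop) (by simp)]
  have hb : (0 : ℝ) < ((1 / 2 : ℂ)).re := by norm_num
  have key := GaussianFourier.integral_cexp_neg_mul_sq_norm_add hb Complex.I t
  have e1 : ∀ x : EuclideanSpace ℝ (Fin d),
      (ENNReal.ofReal ((2 * π) ^ (-(d : ℝ) / 2) * Real.exp (-‖x‖ ^ 2 / 2))).toReal •
        Complex.exp (inner ℝ x t * Complex.I) =
      (((2 * π) ^ (-(d : ℝ) / 2) : ℝ) : ℂ) *
        Complex.exp (-(1 / 2) * ‖x‖ ^ 2 + Complex.I * inner ℝ t x) := by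
    intro x
    rw [ENNReal.toReal_ofReal (by positivity), Complex.real_smul, Complex.ofReal_mul, mul_assoc,
      Complex.ofReal_exp, ← Complex.exp_add, real_inner_comm]
    push_cast
    congr 2
    ring
  simp_rw [e1]
  rw [integral_const_mul, key, finrank_euclideanSpace_fin, ← mul_assoc]
  have e2 : (((2 * π) ^ (-(d : ℝ) / 2) : ℝ) : ℂ) * (π / (1 / 2 : ℂ)) ^ (d / 2 : ℂ) = 1 := by
    have : (π / (1 / 2 : ℂ)) ^ (d / 2 : ℂ) = (((2 * π) ^ ((d : ℝ) / 2) : ℝ) : ℂ) := by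
      rw [Complex.ofReal_cpow (by positivity)]
      push_cast
      congr 1
      ring
    rw [this, ← Complex.ofReal_mul, ← Real.rpow_add (by positivity)]
    simp [neg_div]
  rw [e2, one_mul, Complex.I_sq]
  congr 1
  ring

theorem lintegral_comp_add_smul {E : Type*} [NormedAddCommGroup E] [NormedSpace ℝ E]
    [FiniteDimensional ℝ E] [MeasurableSpace E] [BorelSpace E] (μ : Measure E)
    [μ.IsAddHaarMeasure] (a : E) {s : ℝ} (hs : 0 < s) {f : E → ENNReal} (hf : Measurable f) :
    ∫⁻ z, f (a + s • z) ∂μ = ENNReal.ofReal (s⁻¹ ^ Module.finrank ℝ E) * ∫⁻ x, f x ∂μ := by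
  have h1 : ∫⁻ z, f (a + s • z) ∂μ = ∫⁻ y, f (a + y) ∂(μ.map (s • ·)) := by
    rw [lintegral_map (by fun_prop) (by fun_prop)]
  rw [h1, Measure.map_addHaar_smul μ hs.ne', lintegral_smul_measure, lintegral_add_left_eq_self,
    smul_eq_mul, abs_of_pos (by positivity), inv_pow]

/-- The density of the law of `(y, m y + s Z)` with respect to the product of the law of `y`
and the standard Gaussian. -/
noncomputable def jointDensity (d : ℕ) (m s : ℝ)
    (q : EuclideanSpace ℝ (Fin d) × EuclideanSpace ℝ (Fin d)) : ℝ :=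
  s⁻¹ ^ d * Real.exp (-‖s⁻¹ • (q.2 - m • q.1)‖ ^ 2 / 2 + ‖q.2‖ ^ 2 / 2)

@[fun_prop]
theorem measurable_jointDensity (d : ℕ) (m s : ℝ) : Measurable (jointDensity d m s) := by
  unfold jointDensity
  fun_prop

theorem jointDensity_pos (d : ℕ) (m : ℝ) {s : ℝ} (hs : 0 < s)
    (q : EuclideanSpace ℝ (Fin d) × EuclideanSpace ℝ (Fin d)) : 0 < jointDensity d m s q := by
  unfold jointDensity
  positivity

theorem log_jointDensity (d : ℕ) (m : ℝ) {s : ℝ} (hs : 0 < s) (y z : EuclideanSpace ℝ (Fin d)) :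
    Real.log (jointDensity d m s (y, m • y + s • z)) =
      -(d * Real.log s) - ‖z‖ ^ 2 / 2 + ‖m • y + s • z‖ ^ 2 / 2 := by
  rw [jointDensity, Real.log_mul (by positivity) (by positivity), Real.log_exp, Real.log_pow,
    Real.log_inv, add_sub_cancel_left, inv_smul_smul₀ hs.ne']
  ring

theorem map_prod_stdGaussian_eq_withDensity (d : ℕ)
    (ν : Measure (EuclideanSpace ℝ (Fin d))) [SFinite ν] [SFinite (_root_.stdGaussian d)]
    (m : ℝ) {s : ℝ} (hs : 0 < s) :
    (ν.prod (_root_.stdGaussian d)).map (fun q => (q.1, m • q.1 + s • q.2)) =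
      (ν.prod (_root_.stdGaussian d)).withDensity
        (fun q => ENNReal.ofReal (jointDensity d m s q)) := by
  refine Measure.ext_of_lintegral _ fun f hf => ?_
  rw [lintegral_map hf (by fun_prop), lintegral_withDensity_eq_lintegral_mul _ (by fun_prop) hf,
    lintegral_prod _ (by fun_prop), lintegral_prod _ (by fun_prop)]
  refine lintegral_congr fun y => ?_
  unfold _root_.stdGaussian
  rw [lintegral_withDensity_eq_lintegral_mul _ (by fun_prop) (by fun_prop),
    lintegral_withDensity_eq_lintegral_mul _ (by fun_prop) (by fun_prop)]
  have h1 := lintegral_comp_add_smul (volume : Measure (EuclideanSpace ℝ (Fin d))) (m • y) hs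
    (f := fun x => ENNReal.ofReal ((2 * π) ^ (-(d : ℝ) / 2) *
      Real.exp (-‖s⁻¹ • (x - m • y)‖ ^ 2 / 2)) * f (y, x)) (by fun_prop)
  simp only [add_sub_cancel_left, inv_smul_smul₀ hs.ne'] at h1
  simp only [Pi.mul_apply]
  rw [h1, ← lintegral_const_mul _ (by fun_prop)]
  refine lintegral_congr fun x => ?_
  rw [← mul_assoc, ← mul_assoc, ← ENNReal.ofReal_mul (by positivity),
    ← ENNReal.ofReal_mul (by positivity), jointDensity, finrank_euclideanSpace_fin,
    Real.exp_add, show -‖x‖ ^ 2 / 2 = -(‖x‖ ^ 2 / 2) by ring, Real.exp_neg (‖x‖ ^ 2 / 2)]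
  congr 2
  field_simp

theorem integral_norm_sq_stdGaussian (d : ℕ) :
    ∫ z, ‖z‖ ^ 2 ∂(ProbabilityTheory.stdGaussian (EuclideanSpace ℝ (Fin d))) = d := by
  set γ := ProbabilityTheory.stdGaussian (EuclideanSpace ℝ (Fin d))
  have hL : ∀ i : Fin d, ∫ z, (z i) ^ 2 ∂γ = 1 := by
    intro i
    have h := variance_dual_stdGaussian (innerSL ℝ (EuclideanSpace.single i (1 : ℝ)))
    rw [variance_eq_integral (by fun_prop)] at h
    rw [integral_strongDual_stdGaussian] at h
    simpa [EuclideanSpace.inner_single_left] using h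
  simp_rw [EuclideanSpace.real_norm_sq_eq]
  rw [integral_finsetSum]
  · simp [hL]
  · intro i _
    have h2 : MemLp (fun z : EuclideanSpace ℝ (Fin d) => z) 2 γ := IsGaussian.memLp_two_id
    exact (h2.continuousLinearMap_comp (EuclideanSpace.proj (𝕜 := ℝ) i)).integrable_sq

section

variable {d : ℕ} {Ω : Type*} [MeasurableSpace Ω] {P : Measure Ω}
  {Y Z : Ω → EuclideanSpace ℝ (Fin d)}

theorem memLp_two_of_map_eq_stdGaussian (hZ : Measurable Z)
    (hZlaw : P.map Z = ProbabilityTheory.stdGaussian (EuclideanSpace ℝ (Fin d))) :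
    MemLp Z 2 P := by
  have h : MemLp id 2 (P.map Z) := by rw [hZlaw]; exact IsGaussian.memLp_two_id
  exact (memLp_map_measure_iff (by fun_prop) hZ.aemeasurable).1 h

theorem integral_norm_sq_smul_add_smul [IsProbabilityMeasure P] (hY : MemLp Y 2 P)
    (hZ : Measurable Z)
    (hZlaw : P.map Z = ProbabilityTheory.stdGaussian (EuclideanSpace ℝ (Fin d)))
    (hindep : IndepFun Y Z P) (m s : ℝ) :
    ∫ ω, ‖m • Y ω + s • Z ω‖ ^ 2 ∂P = m ^ 2 * ∫ ω, ‖Y ω‖ ^ 2 ∂P + s ^ 2 * d := by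
  have hZ2 := memLp_two_of_map_eq_stdGaussian hZ hZlaw
  have hZi : ∫ ω, Z ω ∂P = 0 := by
    have := integral_id_stdGaussian (E := EuclideanSpace ℝ (Fin d))
    rwa [← hZlaw, integral_map hZ.aemeasurable (by fun_prop)] at this
  have hZn : ∫ ω, ‖Z ω‖ ^ 2 ∂P = d := by
    rw [← integral_norm_sq_stdGaussian d, ← hZlaw, integral_map hZ.aemeasurable (by fun_prop)]
  have hYint : Integrable Y P := hY.integrable (by norm_num)
  have hZint : Integrable Z P := hZ2.integrable (by norm_num)
  have hcross : ∫ ω, inner ℝ (Y ω) (Z ω) ∂P = 0 := by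
    refine (hindep.integral_bilin hYint hZint (innerSL ℝ)).trans ?_
    rw [hZi, map_zero]
  have hcint : Integrable (fun ω => inner ℝ (Y ω) (Z ω)) P :=
    hindep.integrable_bilin hYint hZint (innerSL ℝ)
  have e : ∀ ω, ‖m • Y ω + s • Z ω‖ ^ 2 =
      m ^ 2 * ‖Y ω‖ ^ 2 + 2 * m * s * inner ℝ (Y ω) (Z ω) + s ^ 2 * ‖Z ω‖ ^ 2 := by
    intro ω
    rw [norm_add_sq_real, norm_smul, norm_smul, mul_pow, mul_pow, real_inner_smul_left,
      real_inner_smul_right, Real.norm_eq_abs, Real.norm_eq_abs, sq_abs, sq_abs]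
    ring
  have i1 := (hY.integrable_norm_pow (by norm_num)).const_mul (m ^ 2)
  have i2 := hcint.const_mul (2 * m * s)
  have i3 := (hZ2.integrable_norm_pow (by norm_num)).const_mul (s ^ 2)
  simp_rw [e]
  rw [integral_add (by exact i1.add i2) i3, integral_add i1 i2, integral_const_mul, integral_const_mul,
    integral_const_mul, hcross, hZn]
  ring

theorem KLdiv_map_smul_add_smul_le [IsProbabilityMeasure P] (hY : Measurable Y)
    (hY2 : MemLp Y 2 P) (hZ : Measurable Z)
    (hZlaw : P.map Z = _root_.stdGaussian d) (hindep : IndepFun Y Z P)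
    (m : ℝ) {s : ℝ} (hs : 0 < s) :
    KLdiv (P.map (fun ω => m • Y ω + s • Z ω)) (_root_.stdGaussian d) ≤
      (1 / 2) * (m ^ 2 * ∫ ω, ‖Y ω‖ ^ 2 ∂P + s ^ 2 * d - d) - d * Real.log s := by
  have hprob : IsProbabilityMeasure (_root_.stdGaussian d) :=
    hZlaw ▸ Measure.isProbabilityMeasure_map hZ.aemeasurable
  have hYprob : IsProbabilityMeasure (P.map Y) := Measure.isProbabilityMeasure_map hY.aemeasurable
  have hZlaw' := hZlaw.trans (stdGaussian_eq_probabilityTheory_stdGaussian d hprob)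
  have hZ2 := memLp_two_of_map_eq_stdGaussian hZ hZlaw'
  set R := (P.map Y).prod (_root_.stdGaussian d) with hR
  set M := P.map (fun ω => (Y ω, m • Y ω + s • Z ω)) with hM
  have hMprob : IsProbabilityMeasure M := Measure.isProbabilityMeasure_map (by fun_prop)
  have hMR : M = R.withDensity (fun q => ENNReal.ofReal (jointDensity d m s q)) := by
    rw [← map_prod_stdGaussian_eq_withDensity d _ m hs, ← hZlaw,
      ← hindep.map_prod_eq_prod_map_map hY.aemeasurable hZ.aemeasurable,
      Measure.map_map (by fun_prop) (by fun_prop)]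
    rfl
  have hac : M ≪ R := hMR ▸ withDensity_absolutelyContinuous _ _
  have hllr : llr M R =ᵐ[M] fun q => Real.log (jointDensity d m s q) := by
    have h := Measure.rnDeriv_withDensity R
      (f := fun q => ENNReal.ofReal (jointDensity d m s q)) (by fun_prop)
    rw [← hMR] at h
    filter_upwards [hac.ae_le h] with q hq
    change Real.log (M.rnDeriv R q).toReal = _
    rw [hq, ENNReal.toReal_ofReal (jointDensity_pos d m hs q).le]
  have hsum : MemLp (fun ω => m • Y ω + s • Z ω) 2 P :=
    (hY2.const_smul m).add (hZ2.const_smul s)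
  have i1 : Integrable (fun ω => ‖Z ω‖ ^ 2 / 2) P :=
    (hZ2.integrable_norm_pow (by norm_num)).div_const 2
  have i2 : Integrable (fun ω => ‖m • Y ω + s • Z ω‖ ^ 2 / 2) P :=
    (hsum.integrable_norm_pow (by norm_num)).div_const 2
  have i0 : Integrable (fun _ : Ω => -(d * Real.log s)) P := integrable_const _
  have hlogm : Measurable fun q => Real.log (jointDensity d m s q) :=
    (measurable_jointDensity d m s).log
  have hint : Integrable (llr M R) M := by
    rw [integrable_congr hllr, hM, integrable_map_measure hlogm.aestronglyMeasurable (by fun_prop)]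
    refine ((i0.sub i1).add i2).congr (ae_of_all _ fun ω => ?_)
    exact (log_jointDensity d m hs (Y ω) (Z ω)).symm
  have hZn : ∫ ω, ‖Z ω‖ ^ 2 ∂P = d := by
    rw [← integral_norm_sq_stdGaussian d, ← hZlaw', integral_map hZ.aemeasurable (by fun_prop)]
  have hval : ∫ q, llr M R q ∂M =
      (1 / 2) * (m ^ 2 * ∫ ω, ‖Y ω‖ ^ 2 ∂P + s ^ 2 * d - d) - d * Real.log s := by
    rw [integral_congr_ae hllr, hM, integral_map (by fun_prop) hlogm.aestronglyMeasurable]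
    simp_rw [log_jointDensity d m hs]
    rw [integral_add (by exact i0.sub i1) i2, integral_sub i0 i1, integral_div, integral_div, hZn,
      integral_norm_sq_smul_add_smul hY2 hZ hZlaw' hindep]
    simp
    ring
  have hsndM : M.map Prod.snd = P.map (fun ω => m • Y ω + s • Z ω) := by
    rw [hM, Measure.map_map (by fun_prop) (by fun_prop)]
    rfl
  have hsndR : R.map Prod.snd = _root_.stdGaussian d := by
    rw [hR, Measure.map_snd_prod]
    simp
  have hacm : M.map Prod.snd ≪ R.map Prod.snd := hac.map measurable_snd
  have hle : (klDiv (M.map Prod.snd) (R.map Prod.snd)).toReal ≤ (klDiv M R).toReal :=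
    ENNReal.toReal_mono (klDiv_ne_top hac hint) (klDiv_map_le _ _ measurable_snd)
  rw [hsndM, hsndR] at hle hacm
  have hlaw : IsProbabilityMeasure (P.map (fun ω => m • Y ω + s • Z ω)) :=
    Measure.isProbabilityMeasure_map (by fun_prop)
  rw [toReal_klDiv_of_measure_eq hacm (by simp), toReal_klDiv_of_measure_eq hac (by simp),
    hval] at hle
  exact hle

end

theorem memLp_two_of_mem_Icc {d : ℕ} {Ω : Type*} [MeasurableSpace Ω] {P : Measure Ω}
    [IsFiniteMeasure P] {Y : Ω → EuclideanSpace ℝ (Fin d)} (hY : Measurable Y)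
    (hsupp : ∀ᵐ ω ∂P, ∀ i, Y ω i ∈ Set.Icc (0 : ℝ) 1) : MemLp Y 2 P := by
  refine MemLp.of_bound hY.aestronglyMeasurable (√d) ?_
  filter_upwards [hsupp] with ω hω
  rw [EuclideanSpace.norm_eq]
  refine Real.sqrt_le_sqrt ?_
  calc ∑ i, ‖Y ω i‖ ^ 2 ≤ ∑ _i : Fin d, (1 : ℝ) := Finset.sum_le_sum fun i _ => by
        rw [Real.norm_eq_abs, sq_abs]
        exact pow_le_one₀ (hω i).1 (hω i).2
    _ = d := by simp

/-- Under the bounded support assumption, for every `T > 0` the law of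
`Y_T = e^{-T} Y₀ + √(1 − e^{-2T}) Z` satisfies
`KL(law(Y_T) | N(0, I_d)) ≤ ½ [ e^{-2T} E‖Y₀‖² − d log(1 − e^{-2T}) − d e^{-2T} ]`. -/
theorem kl_lawYT_le_stdGaussian (d : ℕ) (hd : 1 ≤ d)
    {Ω : Type*} [MeasurableSpace Ω] (P : Measure Ω) [IsProbabilityMeasure P]
    (Y₀ Z : Ω → EuclideanSpace ℝ (Fin d)) (hY₀ : Measurable Y₀) (hZ : Measurable Z)
    (hsupp : ∀ᵐ ω ∂P, ∀ i, Y₀ ω i ∈ Set.Icc (0 : ℝ) 1)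
    (hZlaw : Measure.map Z P = stdGaussian d)
    (hindep : IndepFun Y₀ Z P)
    (T : ℝ) (hT : 0 < T) :
    KLdiv (Measure.map
        (fun ω => Real.exp (-T) • Y₀ ω + Real.sqrt (1 - Real.exp (-2 * T)) • Z ω) P)
        (stdGaussian d) ≤
      (1 / 2) * (Real.exp (-2 * T) * (∫ ω, ‖Y₀ ω‖ ^ 2 ∂P)
        - (d : ℝ) * Real.log (1 - Real.exp (-2 * T)) - (d : ℝ) * Real.exp (-2 * T)) := by
  have hexp : Real.exp (-2 * T) < 1 := Real.exp_zero ▸ Real.exp_lt_exp.2 (by linarith)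
  have hs : 0 < Real.sqrt (1 - Real.exp (-2 * T)) := Real.sqrt_pos.2 (by linarith)
  refine (KLdiv_map_smul_add_smul_le hY₀ (memLp_two_of_mem_Icc hY₀ hsupp) hZ hZlaw hindep
    (Real.exp (-T)) hs).trans_eq ?_
  have hm : Real.exp (-T) ^ 2 = Real.exp (-2 * T) := by
    rw [← Real.exp_nat_mul]
    congr 1
    push_cast
    ring
  rw [hm, Real.sq_sqrt (by linarith), Real.log_sqrt (by linarith)]
  ring
end

section
/- Under the bounded support assumption, for every T ≥ (log 2)/2 one has TV( law(Y_T), N(0, I_d) ) ≤ √d · e^{-T}. -/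
open MeasureTheory Real ProbabilityTheory

/-- Total variation distance `TV(μ, ν) = sup_{A measurable} |μ(A) − ν(A)|`. -/
noncomputable def TVdist {d : ℕ} (μ ν : Measure (EuclideanSpace ℝ (Fin d))) : ℝ :=
  ⨆ A : {s : Set (EuclideanSpace ℝ (Fin d)) // MeasurableSet s},
    |(μ A.1).toReal - (ν A.1).toReal|

/-- The density of `N(0, I_d)`. -/
noncomputable def gaussDensity (d : ℕ) (y : EuclideanSpace ℝ (Fin d)) : ℝ :=
  (2 * π) ^ (-(d : ℝ) / 2) * Real.exp (-‖y‖ ^ 2 / 2)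

/-- The density of `N(m, σ² I_d)`. -/
noncomputable def shiftedGaussDensity (d : ℕ) (σ : ℝ) (m y : EuclideanSpace ℝ (Fin d)) : ℝ :=
  (σ ^ d)⁻¹ * gaussDensity d (σ⁻¹ • (y - m))

lemma gaussDensity_pos (d : ℕ) (y : EuclideanSpace ℝ (Fin d)) : 0 < gaussDensity d y := by
  unfold gaussDensity
  positivity

lemma continuous_gaussDensity (d : ℕ) : Continuous (gaussDensity d) := by
  unfold gaussDensity
  fun_prop

lemma integral_gaussDensity (d : ℕ) : ∫ y, gaussDensity d y = 1 := by
  have h := GaussianFourier.integral_rexp_neg_mul_sq_norm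
    (V := EuclideanSpace ℝ (Fin d)) (b := 1 / 2) (by norm_num)
  have e : ∀ y : EuclideanSpace ℝ (Fin d), gaussDensity d y =
      (2 * π) ^ (-(d : ℝ) / 2) * Real.exp (-(1 / 2) * ‖y‖ ^ 2) := by
    intro y
    unfold gaussDensity
    congr 2
    ring
  simp_rw [e]
  rw [integral_const_mul, h, finrank_euclideanSpace_fin, show π / (1 / 2) = 2 * π by ring,
    ← Real.rpow_add (by positivity), neg_div, neg_add_cancel, Real.rpow_zero]

lemma integrable_gaussDensity (d : ℕ) : Integrable (gaussDensity d) :=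
  integrable_of_integral_eq_one (integral_gaussDensity d)

lemma stdGaussian_apply (d : ℕ) {A : Set (EuclideanSpace ℝ (Fin d))} (hA : MeasurableSet A) :
    _root_.stdGaussian d A = ENNReal.ofReal (∫ y, A.indicator 1 y * gaussDensity d y) := by
  have e : ∀ y, A.indicator (1 : EuclideanSpace ℝ (Fin d) → ℝ) y * gaussDensity d y =
      A.indicator (gaussDensity d) y := by
    intro y
    by_cases h : y ∈ A <;> simp [h]
  simp_rw [e]
  rw [integral_indicator hA, ofReal_integral_eq_lintegral_ofReal
    (integrable_gaussDensity d).integrableOn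
    (Filter.Eventually.of_forall fun y => (gaussDensity_pos d y).le)]
  exact withDensity_apply _ hA

instance isProbabilityMeasure_stdGaussian_withDensity (d : ℕ) :
    IsProbabilityMeasure (_root_.stdGaussian d) := by
  constructor
  rw [stdGaussian_apply d MeasurableSet.univ]
  simp [integral_gaussDensity]

lemma integral_comp_affine_mul_gaussDensity (d : ℕ) {σ : ℝ} (hσ : 0 < σ)
    (m : EuclideanSpace ℝ (Fin d)) (g : EuclideanSpace ℝ (Fin d) → ℝ) :
    ∫ z, g (m + σ • z) * gaussDensity d z = ∫ u, g u * shiftedGaussDensity d σ m u := by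
  have h := integral_sub_right_eq_self (μ := volume)
    (fun u : EuclideanSpace ℝ (Fin d) => g (m + u) * ((σ ^ d)⁻¹ * gaussDensity d (σ⁻¹ • u))) m
  have h2 := Measure.integral_comp_smul (volume : Measure (EuclideanSpace ℝ (Fin d)))
    (fun u => g (m + u) * gaussDensity d (σ⁻¹ • u)) σ
  simp only [inv_smul_smul₀ hσ.ne', finrank_euclideanSpace_fin] at h2
  simp only [add_sub_cancel] at h
  unfold shiftedGaussDensity
  rw [h, h2, abs_of_pos (by positivity), smul_eq_mul, ← integral_const_mul]
  congr 1 with u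
  ring

lemma integral_shiftedGaussDensity (d : ℕ) {σ : ℝ} (hσ : 0 < σ)
    (m : EuclideanSpace ℝ (Fin d)) : ∫ u, shiftedGaussDensity d σ m u = 1 := by
  have h := integral_comp_affine_mul_gaussDensity d hσ m 1
  simpa [integral_gaussDensity] using h.symm

lemma shiftedGaussDensity_sq_div (d : ℕ) {x : ℝ} (hx0 : 0 ≤ x) (hx1 : x < 1)
    (m u : EuclideanSpace ℝ (Fin d)) :
    shiftedGaussDensity d √(1 - x) m u ^ 2 / gaussDensity d u =
      (((1 - x) ^ d)⁻¹ * (2 * π) ^ (-(d : ℝ) / 2) * Real.exp (‖m‖ ^ 2 / (1 + x))) *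
        Real.exp (-((1 + x) / (2 * (1 - x))) * ‖u - (2 / (1 + x)) • m‖ ^ 2) := by
  have hv : 0 < 1 - x := by linarith
  have hv' : 0 < 1 + x := by linarith
  have hsq : √(1 - x) ^ 2 = 1 - x := Real.sq_sqrt hv.le
  have hC : (0 : ℝ) < (2 * π) ^ (-(d : ℝ) / 2) := by positivity
  unfold shiftedGaussDensity gaussDensity
  set C := (2 * π) ^ (-(d : ℝ) / 2)
  have n1 : ‖(√(1 - x))⁻¹ • (u - m)‖ ^ 2 =
      (‖u‖ ^ 2 - 2 * inner ℝ u m + ‖m‖ ^ 2) / (1 - x) := by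
    rw [norm_smul, mul_pow, norm_sub_sq_real, norm_inv, Real.norm_eq_abs, inv_pow, sq_abs, hsq]
    field_simp
  have n2 : ‖u - (2 / (1 + x)) • m‖ ^ 2 =
      ‖u‖ ^ 2 - 2 * (2 / (1 + x) * inner ℝ u m) + (2 / (1 + x)) ^ 2 * ‖m‖ ^ 2 := by
    rw [norm_sub_sq_real, inner_smul_right, norm_smul, mul_pow, Real.norm_eq_abs, sq_abs]
  rw [n1, n2, mul_pow, inv_pow, ← pow_mul, mul_comm d 2, pow_mul, hsq, mul_pow,
    ← Real.exp_nat_mul, mul_div_assoc, mul_div_mul_comm, ← Real.exp_sub, sq,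
    mul_div_cancel_right₀ _ hC.ne', mul_assoc _ (Real.exp _) (Real.exp _), ← Real.exp_add, mul_assoc]
  congr 3
  push_cast
  field_simp
  ring

lemma integral_shiftedGaussDensity_sq_div (d : ℕ) {x : ℝ} (hx0 : 0 ≤ x) (hx1 : x < 1)
    (m : EuclideanSpace ℝ (Fin d)) :
    ∫ u, shiftedGaussDensity d √(1 - x) m u ^ 2 / gaussDensity d u =
      ((1 - x ^ 2)⁻¹) ^ ((d : ℝ) / 2) * Real.exp (‖m‖ ^ 2 / (1 + x)) := by
  have hv : 0 < 1 - x := by linarith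
  have hv' : 0 < 1 + x := by linarith
  simp_rw [shiftedGaussDensity_sq_div d hx0 hx1]
  rw [integral_const_mul, integral_sub_right_eq_self
      (fun u : EuclideanSpace ℝ (Fin d) => Real.exp (-((1 + x) / (2 * (1 - x))) * ‖u‖ ^ 2)),
    GaussianFourier.integral_rexp_neg_mul_sq_norm (by positivity), finrank_euclideanSpace_fin,
    show π / ((1 + x) / (2 * (1 - x))) = (2 * π) * ((1 - x) ^ 2 * (1 - x ^ 2)⁻¹) by
      rw [show 1 - x ^ 2 = (1 - x) * (1 + x) by ring]
      field_simp,
    Real.mul_rpow (by positivity) (mul_nonneg (by positivity) (inv_nonneg.2 (by nlinarith))),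
    Real.mul_rpow (by positivity) (inv_nonneg.2 (by nlinarith)),
    ← Real.rpow_natCast (1 - x) 2, ← Real.rpow_mul hv.le,
    show ((2 : ℕ) : ℝ) * (d / 2) = d by push_cast; ring, Real.rpow_natCast, neg_div,
    Real.rpow_neg (by positivity)]
  field_simp

lemma inv_one_sub_sq_rpow_mul_exp_le (d : ℕ) {x M : ℝ} (hx0 : 0 ≤ x) (hx : x ≤ 1 / 2)
    (hM : M ≤ d * x) (hdx : d * x ≤ 1) :
    ((1 - x ^ 2)⁻¹) ^ ((d : ℝ) / 2) * Real.exp (M / (1 + x)) ≤ 1 + 4 * (d * x) := by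
  have hw : 0 < 1 - x ^ 2 := by nlinarith
  have hd0 : (0 : ℝ) ≤ d := d.cast_nonneg
  have h1 : ((1 - x ^ 2)⁻¹) ≤ Real.exp (x ^ 2 / (1 - x ^ 2)) := by
    have := Real.add_one_le_exp (x ^ 2 / (1 - x ^ 2))
    have e : x ^ 2 / (1 - x ^ 2) + 1 = (1 - x ^ 2)⁻¹ := by
      field_simp
      ring
    rwa [e] at this
  have h2 : ((1 - x ^ 2)⁻¹) ^ ((d : ℝ) / 2) ≤ Real.exp (x ^ 2 / (1 - x ^ 2) * (d / 2)) := by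
    rw [Real.exp_mul]
    exact Real.rpow_le_rpow (by positivity) h1 (by positivity)
  have h3 : x ^ 2 / (1 - x ^ 2) * (d / 2) + M / (1 + x) ≤ d * x := by
    have h4 : M / (1 + x) ≤ d * x / (1 + x) := by gcongr
    have h5 : d * x - (x ^ 2 / (1 - x ^ 2) * (d / 2) + d * x / (1 + x)) =
        d * x * (x * (1 - 2 * x)) / (2 * (1 - x ^ 2)) := by
      have : 1 + x ≠ 0 := by positivity
      have : 1 - x ≠ 0 := by linarith
      rw [show 1 - x ^ 2 = (1 - x) * (1 + x) by ring]
      field_simp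
      ring
    have h6 : 0 ≤ d * x * (x * (1 - 2 * x)) / (2 * (1 - x ^ 2)) := by
      have : 0 ≤ 1 - 2 * x := by linarith
      positivity
    linarith
  have hs0 : 0 ≤ d * x := by positivity
  calc _ ≤ Real.exp (x ^ 2 / (1 - x ^ 2) * (d / 2)) * Real.exp (M / (1 + x)) := by gcongr
    _ ≤ Real.exp (d * x) := by rw [← Real.exp_add]; exact Real.exp_le_exp.2 h3
    _ ≤ _ := by
      have := (abs_le.1 (Real.abs_exp_sub_one_sub_id_le (abs_le.2 ⟨by linarith, hdx⟩))).2
      nlinarith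

/-- If `p` and `q > 0` are densities with `χ²(p, q) ≤ 4 s²`, then `|p(A) - q(A)| ≤ s`. -/
lemma abs_integral_indicator_sub_le {α : Type*} [MeasurableSpace α] {ν : Measure α}
    {p q : α → ℝ} (hq0 : ∀ u, 0 < q u) (hp : ∫ u, p u ∂ν = 1) (hq : ∫ u, q u ∂ν = 1)
    (hpq : Integrable (fun u => p u ^ 2 / q u) ν) {s : ℝ} (hs : 0 < s)
    (hchi : ∫ u, p u ^ 2 / q u ∂ν ≤ 1 + 4 * s ^ 2) {A : Set α} (hA : MeasurableSet A) :
    |∫ u, A.indicator 1 u * p u ∂ν - ∫ u, A.indicator 1 u * q u ∂ν| ≤ s := by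
  have ip := integrable_of_integral_eq_one hp
  have iq := integrable_of_integral_eq_one hq
  have e : ∀ f : α → ℝ, (fun u => A.indicator (1 : α → ℝ) u * f u) = A.indicator f := by
    intro f
    ext u
    by_cases h : u ∈ A <;> simp [h]
  have iAp : Integrable (fun u => A.indicator (1 : α → ℝ) u * p u) ν := by
    rw [e]; exact ip.indicator hA
  have iAq : Integrable (fun u => A.indicator (1 : α → ℝ) u * q u) ν := by
    rw [e]; exact iq.indicator hA
  have iA : Integrable
      (fun u => A.indicator (1 : α → ℝ) u * p u - A.indicator (1 : α → ℝ) u * q u) ν := iAp.sub iAq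
  have i1 : Integrable (fun u => p u ^ 2 / q u - 2 * p u) ν := hpq.sub (ip.const_mul 2)
  have i2 : Integrable (fun u => p u ^ 2 / q u - 2 * p u + q u) ν := i1.add iq
  have i3 : Integrable (fun u => p u - q u) ν := ip.sub iq
  have key : ∫ u, A.indicator 1 u * p u ∂ν - ∫ u, A.indicator 1 u * q u ∂ν =
      ∫ u, (A.indicator 1 u * p u - A.indicator 1 u * q u) - 2⁻¹ * (p u - q u) ∂ν := by
    rw [integral_sub iA (i3.const_mul _), integral_sub iAp iAq,
      integral_const_mul, integral_sub ip iq, hp, hq]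
    ring
  have iB : Integrable (fun u => (8 * s)⁻¹ * (p u ^ 2 / q u - 2 * p u + q u) + s / 2 * q u) ν :=
    (i2.const_mul _).add (iq.const_mul _)
  have hB : ∫ u, (8 * s)⁻¹ * (p u ^ 2 / q u - 2 * p u + q u) + s / 2 * q u ∂ν ≤ s := by
    rw [integral_add (i2.const_mul _) (iq.const_mul _),
      integral_const_mul, integral_const_mul, integral_add i1 iq,
      integral_sub hpq (ip.const_mul 2), integral_const_mul, hp, hq]
    have : (8 * s)⁻¹ * (∫ u, p u ^ 2 / q u ∂ν - 2 * 1 + 1) ≤ (8 * s)⁻¹ * (4 * s ^ 2) := by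
      gcongr
      linarith
    have h2 : (8 * s)⁻¹ * (4 * s ^ 2) = s / 2 := by
      field_simp
      norm_num
    linarith
  rw [key, ← Real.norm_eq_abs]
  refine (norm_integral_le_of_norm_le iB (Filter.Eventually.of_forall fun u => ?_)).trans hB
  have habs : ‖A.indicator (1 : α → ℝ) u * p u - A.indicator (1 : α → ℝ) u * q u
      - 2⁻¹ * (p u - q u)‖ = 2⁻¹ * |p u - q u| := by
    rw [Real.norm_eq_abs, ← abs_of_pos (show (0 : ℝ) < 2⁻¹ by norm_num), ← abs_mul,
      abs_of_pos (show (0 : ℝ) < 2⁻¹ by norm_num)]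
    by_cases h : u ∈ A
    · simp only [Set.indicator_of_mem h, Pi.one_apply]
      congr 1
      ring
    · simp only [Set.indicator_of_notMem h]
      rw [← abs_neg]
      congr 1
      ring
  have hqu := hq0 u
  have hid : (8 * s)⁻¹ * (p u ^ 2 / q u - 2 * p u + q u) + s / 2 * q u - 2⁻¹ * |p u - q u| =
      (|p u - q u| - 2 * s * q u) ^ 2 / (8 * s * q u) := by
    rw [sub_sq, sq_abs]
    field_simp
    ring
  have : 0 ≤ (|p u - q u| - 2 * s * q u) ^ 2 / (8 * s * q u) := by positivity
  rw [habs]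
  linarith

lemma measurable_affine {d : ℕ} (m : EuclideanSpace ℝ (Fin d)) (σ : ℝ) :
    Measurable fun z : EuclideanSpace ℝ (Fin d) => m + σ • z := by
  fun_prop

/-- The total variation bound between `N(m, (1 - x) I_d)` and `N(0, I_d)`, setwise. -/
lemma abs_stdGaussian_preimage_sub_le (d : ℕ) {x : ℝ} (hx0 : 0 < x) (hx : x ≤ 1 / 2) (hd : 1 ≤ d)
    {m : EuclideanSpace ℝ (Fin d)} (hm : ‖m‖ ^ 2 ≤ d * x)
    {A : Set (EuclideanSpace ℝ (Fin d))} (hA : MeasurableSet A) :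
    |(_root_.stdGaussian d).real ((fun z => m + √(1 - x) • z) ⁻¹' A) -
      (_root_.stdGaussian d).real A| ≤ √(d * x) := by
  have hdx0 : 0 < d * x := by positivity
  rcases le_total (d * x) 1 with hdx | hdx
  · have hσ : 0 < √(1 - x) := Real.sqrt_pos.2 (by linarith)
    have hI := integral_shiftedGaussDensity_sq_div d hx0.le (by linarith) m
    have hreal : ∀ B : Set (EuclideanSpace ℝ (Fin d)), MeasurableSet B →
        (_root_.stdGaussian d).real B = ∫ y, B.indicator 1 y * gaussDensity d y := by
      intro B hB
      rw [measureReal_def, stdGaussian_apply d hB, ENNReal.toReal_ofReal]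
      exact integral_nonneg fun y => mul_nonneg
        (Set.indicator_nonneg (fun _ _ => zero_le_one) _) (gaussDensity_pos d y).le
    rw [hreal _ (measurable_affine m _ hA), hreal _ hA]
    have hchange := integral_comp_affine_mul_gaussDensity d hσ m (A.indicator 1)
    have hind : ∀ z, ((fun z => m + √(1 - x) • z) ⁻¹' A).indicator
        (1 : EuclideanSpace ℝ (Fin d) → ℝ) z = A.indicator 1 (m + √(1 - x) • z) := fun z => rfl
    simp_rw [hind]
    rw [hchange]
    refine abs_integral_indicator_sub_le (gaussDensity_pos d)
      (integral_shiftedGaussDensity d hσ m) (integral_gaussDensity d)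
      (Integrable.of_integral_ne_zero ?_) (Real.sqrt_pos.2 hdx0) ?_ hA
    · rw [hI]
      have : 0 < 1 - x ^ 2 := by nlinarith
      positivity
    · rw [hI, Real.sq_sqrt hdx0.le]
      exact inv_one_sub_sq_rpow_mul_exp_le d hx0.le hx hm hdx
  · refine le_trans ?_ (Real.one_le_sqrt.2 hdx)
    exact abs_sub_le_of_le_of_le measureReal_nonneg measureReal_le_one measureReal_nonneg
      measureReal_le_one |>.trans (by norm_num)

lemma abs_measureReal_map_sub_le {Ω E F G : Type*} [MeasurableSpace Ω] [MeasurableSpace E]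
    [MeasurableSpace F] [MeasurableSpace G]
    {P : Measure Ω} [IsProbabilityMeasure P] {X : Ω → E} {Y : Ω → F} (hX : Measurable X)
    (hY : Measurable Y) (hindep : IndepFun X Y P) {φ : E × F → G} (hφ : Measurable φ)
    {A : Set G} (hA : MeasurableSet A) {a c : ℝ}
    (h : ∀ᵐ ω ∂P, |(P.map Y).real ((fun z => φ (X ω, z)) ⁻¹' A) - a| ≤ c) :
    |(P.map fun ω => φ (X ω, Y ω)).real A - a| ≤ c := by
  have : IsProbabilityMeasure (P.map X) := Measure.isProbabilityMeasure_map hX.aemeasurable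
  have : IsProbabilityMeasure (P.map Y) := Measure.isProbabilityMeasure_map hY.aemeasurable
  have hφA : MeasurableSet (φ ⁻¹' A) := hφ hA
  have hmeas : Measurable fun x => (P.map Y) (Prod.mk x ⁻¹' (φ ⁻¹' A)) :=
    measurable_measure_prodMk_left hφA
  have hint : Integrable (fun ω => (P.map Y).real ((fun z => φ (X ω, z)) ⁻¹' A)) P := by
    refine Integrable.of_bound (hmeas.comp hX).ennreal_toReal.aestronglyMeasurable 1
      (Filter.Eventually.of_forall fun ω => ?_)
    rw [Real.norm_of_nonneg measureReal_nonneg]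
    exact measureReal_le_one
  have hlaw : (P.map fun ω => φ (X ω, Y ω)).real A =
      ∫ ω, (P.map Y).real ((fun z => φ (X ω, z)) ⁻¹' A) ∂P := by
    have e : (P.map fun ω => φ (X ω, Y ω)) = ((P.map X).prod (P.map Y)).map φ := by
      rw [← (indepFun_iff_map_prod_eq_prod_map_map hX.aemeasurable hY.aemeasurable).1 hindep,
        Measure.map_map hφ (hX.prodMk hY)]
      rfl
    rw [measureReal_def, e, Measure.map_apply hφ hA, Measure.prod_apply hφA,
      lintegral_map hmeas hX]
    exact (integral_toReal (hmeas.comp hX).aemeasurable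
      (Filter.Eventually.of_forall fun ω => measure_lt_top _ _)).symm
  have hsub : (P.map fun ω => φ (X ω, Y ω)).real A - a =
      ∫ ω, ((P.map Y).real ((fun z => φ (X ω, z)) ⁻¹' A) - a) ∂P := by
    rw [integral_sub hint (integrable_const a), ← hlaw]
    simp
  rw [hsub, ← Real.norm_eq_abs]
  simpa using norm_integral_le_of_norm_le_const (μ := P)
    (f := fun ω => (P.map Y).real ((fun z => φ (X ω, z)) ⁻¹' A) - a) h

lemma norm_sq_le_of_mem_unit_cube {d : ℕ} {y : EuclideanSpace ℝ (Fin d)}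
    (hy : ∀ i, y i ∈ Set.Icc (0 : ℝ) 1) : ‖y‖ ^ 2 ≤ d := by
  rw [EuclideanSpace.real_norm_sq_eq]
  calc ∑ i, y i ^ 2 ≤ ∑ _i : Fin d, (1 : ℝ) :=
        Finset.sum_le_sum fun i _ => pow_le_one₀ (hy i).1 (hy i).2
    _ = d := by simp

/-- Under the bounded support assumption, for every `T ≥ (log 2)/2` the law of
`Y_T = e^{-T} Y₀ + √(1 − e^{-2T}) Z` satisfies `TV(law(Y_T), N(0, I_d)) ≤ √d · e^{-T}`. -/
theorem tv_lawYT_le_stdGaussian (d : ℕ) (hd : 1 ≤ d)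
    {Ω : Type*} [MeasurableSpace Ω] (P : Measure Ω) [IsProbabilityMeasure P]
    (Y₀ Z : Ω → EuclideanSpace ℝ (Fin d)) (hY₀ : Measurable Y₀) (hZ : Measurable Z)
    (hsupp : ∀ᵐ ω ∂P, ∀ i, Y₀ ω i ∈ Set.Icc (0 : ℝ) 1)
    (hZlaw : Measure.map Z P = stdGaussian d)
    (hindep : IndepFun Y₀ Z P)
    (T : ℝ) (hT : Real.log 2 / 2 ≤ T) :
    TVdist (Measure.map
        (fun ω => Real.exp (-T) • Y₀ ω + Real.sqrt (1 - Real.exp (-2 * T)) • Z ω) P)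
        (stdGaussian d) ≤
      Real.sqrt d * Real.exp (-T) := by
  have hexp : Real.exp (-2 * T) = Real.exp (-T) ^ 2 := by
    rw [← Real.exp_nat_mul]
    congr 1
    push_cast
    ring
  have hx : Real.exp (-2 * T) ≤ 1 / 2 := by
    have h : Real.exp (-2 * T) ≤ Real.exp (-Real.log 2) := Real.exp_le_exp.2 (by linarith)
    rwa [Real.exp_neg, Real.exp_log two_pos, ← one_div] at h
  have hbound : √d * Real.exp (-T) = √(d * Real.exp (-2 * T)) := by
    rw [hexp, Real.sqrt_mul d.cast_nonneg, Real.sqrt_sq (Real.exp_pos _).le]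
  have : Nonempty {s : Set (EuclideanSpace ℝ (Fin d)) // MeasurableSet s} :=
    ⟨⟨∅, MeasurableSet.empty⟩⟩
  rw [hbound]
  refine ciSup_le fun ⟨A, hA⟩ => ?_
  refine abs_measureReal_map_sub_le hY₀ hZ hindep
    (φ := fun w => Real.exp (-T) • w.1 + √(1 - Real.exp (-2 * T)) • w.2) (by fun_prop) hA ?_
  filter_upwards [hsupp] with ω hω
  rw [hZlaw]
  refine abs_stdGaussian_preimage_sub_le d (Real.exp_pos _) hx hd ?_ hA
  rw [norm_smul, mul_pow, Real.norm_of_nonneg (Real.exp_pos _).le, ← hexp, mul_comm]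
  exact mul_le_mul_of_nonneg_right (norm_sq_le_of_mem_unit_cube hω) (Real.exp_pos _).le
end

section
/- Under the bounded support assumption, if 0 < T₀ < (log 2)/2, then for every t ≥ T₀ the map y ↦ b(t, y) = y + 2 ∇_y log p_t(y) is Lipschitz continuous on ℝ^d (with respect to the Euclidean norm) with Lipschitz constant at most 2d/T₀². -/
open MeasureTheory Real

/-- The density `p_t(y) = ∫ (2π σ_t²)^{-d/2} exp(−‖y − μ_t y₀‖²/(2σ_t²)) p₀(dy₀)` of
`Y_t = e^{-t} Y₀ + √(1 − e^{-2t}) Z` where `Y₀ ~ p₀`, with `μ_t = e^{-t}`,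
`σ_t² = 1 − e^{-2t}`. -/
noncomputable def pt (d : ℕ) (p₀ : Measure (EuclideanSpace ℝ (Fin d))) (t : ℝ)
    (y : EuclideanSpace ℝ (Fin d)) : ℝ :=
  ∫ y₀, (2 * π * (1 - Real.exp (-2 * t))) ^ (-(d : ℝ) / 2) *
      Real.exp (-‖y - Real.exp (-t) • y₀‖ ^ 2 / (2 * (1 - Real.exp (-2 * t)))) ∂p₀

/-- The drift `b(t, y) = y + 2 ∇_y log p_t(y)`. -/
noncomputable def drift (d : ℕ) (p₀ : Measure (EuclideanSpace ℝ (Fin d))) (t : ℝ)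
    (y : EuclideanSpace ℝ (Fin d)) : EuclideanSpace ℝ (Fin d) :=
  y + (2 : ℝ) • gradient (fun z => Real.log (pt d p₀ t z)) y

section ExponentialFamily

variable {Ω E F : Type*} [MeasurableSpace Ω] {μ : Measure Ω}
  [NormedAddCommGroup E] [InnerProductSpace ℝ E] [NormedAddCommGroup F] [NormedSpace ℝ F]
  {X : Ω → E} {R : ℝ}

theorem exp_inner_le_of_norm_le {u x : E} {r : ℝ} (hu : ‖u‖ ≤ r) (hx : ‖x‖ ≤ R) :
    Real.exp (inner ℝ u x) ≤ Real.exp (r * R) := by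
  refine Real.exp_le_exp.2 ((real_inner_le_norm u x).trans ?_)
  have := norm_nonneg u
  gcongr
  exact this.trans hu

theorem aestronglyMeasurable_exp_inner (hX : AEStronglyMeasurable X μ) (u : E) :
    AEStronglyMeasurable (fun ω => Real.exp (inner ℝ u (X ω))) μ :=
  Real.continuous_exp.comp_aestronglyMeasurable (aestronglyMeasurable_const.inner hX)

theorem integrable_exp_inner_smul (hX : AEStronglyMeasurable X μ) (hR : ∀ᵐ ω ∂μ, ‖X ω‖ ≤ R)
    {f : Ω → F} (hf : Integrable f μ) (u : E) :
    Integrable (fun ω => Real.exp (inner ℝ u (X ω)) • f ω) μ := by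
  refine hf.bdd_smul (Real.exp (‖u‖ * R)) (aestronglyMeasurable_exp_inner hX u) ?_
  filter_upwards [hR] with ω hω
  rw [Real.norm_eq_abs, Real.abs_exp]
  exact exp_inner_le_of_norm_le le_rfl hω

theorem aestronglyMeasurable_innerSL_smulRight (hX : AEStronglyMeasurable X μ) {f : Ω → F}
    (hf : AEStronglyMeasurable f μ) :
    AEStronglyMeasurable (fun ω => (innerSL ℝ (X ω)).smulRight (f ω)) μ := by
  have h : Continuous fun p : E × F => (innerSL ℝ p.1).smulRight p.2 := by fun_prop
  exact h.comp_aestronglyMeasurable (hX.prodMk hf)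

theorem hasFDerivAt_integral_exp_inner_smul (hX : AEStronglyMeasurable X μ)
    (hR : ∀ᵐ ω ∂μ, ‖X ω‖ ≤ R) {f : Ω → F} (hf : Integrable f μ) (u : E) :
    HasFDerivAt (fun u => ∫ ω, Real.exp (inner ℝ u (X ω)) • f ω ∂μ)
      (∫ ω, Real.exp (inner ℝ u (X ω)) • (innerSL ℝ (X ω)).smulRight (f ω) ∂μ) u := by
  refine hasFDerivAt_integral_of_dominated_of_fderiv_le
    (F := fun u ω => Real.exp (inner ℝ u (X ω)) • f ω)
    (F' := fun u ω => Real.exp (inner ℝ u (X ω)) • (innerSL ℝ (X ω)).smulRight (f ω))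
    (bound := fun ω => Real.exp ((‖u‖ + 1) * R) * R * ‖f ω‖)
    (Metric.ball_mem_nhds u one_pos) ?_ ?_ ?_ ?_ ?_ ?_
  · exact .of_forall fun v => (integrable_exp_inner_smul hX hR hf v).aestronglyMeasurable
  · exact integrable_exp_inner_smul hX hR hf u
  · exact (aestronglyMeasurable_exp_inner hX u).smul
      (aestronglyMeasurable_innerSL_smulRight hX hf.aestronglyMeasurable)
  · filter_upwards [hR] with ω hω v hv
    have hv' : ‖v‖ ≤ ‖u‖ + 1 := by
      have h := norm_sub_norm_le v u
      rw [mem_ball_iff_norm] at hv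
      linarith
    rw [norm_smul, Real.norm_eq_abs, Real.abs_exp, ContinuousLinearMap.norm_smulRight_apply,
      innerSL_apply_norm, mul_assoc]
    exact mul_le_mul (exp_inner_le_of_norm_le hv' hω) (by gcongr) (by positivity) (by positivity)
  · exact hf.norm.const_mul _
  · refine .of_forall fun ω v _ => ?_
    have h : HasFDerivAt (fun v => inner ℝ v (X ω)) (innerSL ℝ (X ω)) v :=
      (innerSL ℝ (X ω)).hasFDerivAt.congr_of_eventuallyEq
        (.of_forall fun _ => real_inner_comm _ _)
    convert h.exp.smul_const (f ω) using 1
    ext w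
    simp [mul_smul]

variable {g : Ω → ℝ}

theorem norm_integral_exp_inner_smul_le (hX : AEStronglyMeasurable X μ)
    (hR : ∀ᵐ ω ∂μ, ‖X ω‖ ≤ R) (hg : Integrable g μ) {f : Ω → F} {K : ℝ}
    (hf : ∀ᵐ ω ∂μ, ‖f ω‖ ≤ K * g ω) (u : E) :
    ‖∫ ω, Real.exp (inner ℝ u (X ω)) • f ω ∂μ‖ ≤
      K * ∫ ω, Real.exp (inner ℝ u (X ω)) • g ω ∂μ := by
  rw [← integral_const_mul]
  refine norm_integral_le_of_norm_le ((integrable_exp_inner_smul hX hR hg u).const_mul K) ?_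
  filter_upwards [hf] with ω hω
  rw [norm_smul, Real.norm_eq_abs, Real.abs_exp, smul_eq_mul, mul_left_comm]
  gcongr

theorem integral_exp_inner_smul_pos [NeZero μ] (hX : AEStronglyMeasurable X μ)
    (hR : ∀ᵐ ω ∂μ, ‖X ω‖ ≤ R) (hg : Integrable g μ) (hg0 : ∀ ω, 0 < g ω) (u : E) :
    0 < ∫ ω, Real.exp (inner ℝ u (X ω)) • g ω ∂μ := by
  have hpos : ∀ ω, 0 < Real.exp (inner ℝ u (X ω)) • g ω :=
    fun ω => mul_pos (Real.exp_pos _) (hg0 ω)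
  rw [integral_pos_iff_support_of_nonneg (fun ω => (hpos ω).le)
    (integrable_exp_inner_smul hX hR hg u)]
  have h : Function.support (fun ω => Real.exp (inner ℝ u (X ω)) • g ω) = Set.univ :=
    Set.eq_univ_of_forall fun ω => (hpos ω).ne'
  rw [h]
  exact NeZero.pos _

/-- The mean of `X` under the measure with density proportional to `g · exp ⟪u, X⟫`. -/
noncomputable def tiltedMean (μ : Measure Ω) (g : Ω → ℝ) (X : Ω → E) (u : E) : E :=
  (∫ ω, Real.exp (inner ℝ u (X ω)) • g ω ∂μ)⁻¹ •
    ∫ ω, Real.exp (inner ℝ u (X ω)) • g ω • X ω ∂μ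

theorem integrable_smul_of_norm_le (hX : AEStronglyMeasurable X μ)
    (hR : ∀ᵐ ω ∂μ, ‖X ω‖ ≤ R) (hg : Integrable g μ) : Integrable (fun ω => g ω • X ω) μ :=
  hg.smul_bdd R hX hR

theorem norm_tiltedMean_sub_le [NeZero μ] (hX : AEStronglyMeasurable X μ)
    (hR : ∀ᵐ ω ∂μ, ‖X ω‖ ≤ R) (hg : Integrable g μ) (hg0 : ∀ ω, 0 < g ω) (u v : E) :
    ‖tiltedMean μ g X u - tiltedMean μ g X v‖ ≤ 2 * R ^ 2 * ‖u - v‖ := by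
  have hR0 : 0 ≤ R := by
    obtain ⟨ω, hω⟩ := hR.exists
    exact (norm_nonneg _).trans hω
  have hderiv := fun w => ((hasDerivAt_inv
      (integral_exp_inner_smul_pos hX hR hg hg0 w).ne').comp_hasFDerivAt w
        (hasFDerivAt_integral_exp_inner_smul hX hR hg w)).smul
    (hasFDerivAt_integral_exp_inner_smul hX hR (integrable_smul_of_norm_le hX hR hg) w)
  refine convex_univ.norm_image_sub_le_of_norm_hasFDerivWithin_le
    (fun w _ => (hderiv w).hasFDerivWithinAt) (fun w _ => ?_) (Set.mem_univ v) (Set.mem_univ u)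
  have hZ := integral_exp_inner_smul_pos hX hR hg hg0 w
  have hN := norm_integral_exp_inner_smul_le hX hR hg (f := fun ω => g ω • X ω) (K := R) (by
    filter_upwards [hR] with ω hω
    rw [norm_smul, Real.norm_of_nonneg (hg0 ω).le, mul_comm]
    have := (hg0 ω).le
    gcongr) w
  have hZ' := norm_integral_exp_inner_smul_le hX hR hg
    (f := fun ω => (innerSL ℝ (X ω)).smulRight (g ω)) (K := R) (by
    filter_upwards [hR] with ω hω
    rw [ContinuousLinearMap.norm_smulRight_apply, innerSL_apply_norm,
      Real.norm_of_nonneg (hg0 ω).le]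
    have := (hg0 ω).le
    gcongr) w
  have hN' := norm_integral_exp_inner_smul_le hX hR hg
    (f := fun ω => (innerSL ℝ (X ω)).smulRight (g ω • X ω)) (K := R ^ 2) (by
    filter_upwards [hR] with ω hω
    rw [ContinuousLinearMap.norm_smulRight_apply, innerSL_apply_norm, norm_smul,
      Real.norm_of_nonneg (hg0 ω).le]
    have := (hg0 ω).le
    calc ‖X ω‖ * (g ω * ‖X ω‖) ≤ R * (g ω * R) := by gcongr
      _ = R ^ 2 * g ω := by ring) w
  simp only [Function.comp_apply]
  set Z := ∫ ω, Real.exp (inner ℝ w (X ω)) • g ω ∂μ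
  refine (norm_add_le _ _).trans ?_
  simp only [norm_smul, ContinuousLinearMap.norm_smulRight_apply, norm_neg, norm_inv, norm_pow,
    Real.norm_of_nonneg hZ.le]
  calc _ ≤ Z⁻¹ * (R ^ 2 * Z) + (Z ^ 2)⁻¹ * (R * Z) * (R * Z) := by gcongr
    _ = 2 * R ^ 2 := by field_simp; ring

theorem hasGradientAt_log_integral_exp_inner [CompleteSpace E] [NeZero μ]
    (hX : AEStronglyMeasurable X μ) (hR : ∀ᵐ ω ∂μ, ‖X ω‖ ≤ R) (hg : Integrable g μ)
    (hg0 : ∀ ω, 0 < g ω) (u : E) :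
    HasGradientAt (fun u => Real.log (∫ ω, Real.exp (inner ℝ u (X ω)) • g ω ∂μ))
      (tiltedMean μ g X u) u := by
  rw [hasGradientAt_iff_hasFDerivAt]
  refine ((hasFDerivAt_integral_exp_inner_smul hX hR hg u).log
    (integral_exp_inner_smul_pos hX hR hg hg0 u).ne').congr_fderiv (Eq.symm ?_)
  rw [tiltedMean, map_smulₛₗ, conj_trivial]
  congr 1
  have hi := integrable_exp_inner_smul hX hR (integrable_smul_of_norm_le hX hR hg) u
  refine ((innerSL ℝ).integral_comp_comm hi).symm.trans (integral_congr_ae (.of_forall fun ω => ?_))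
  ext w
  have h : (innerSL ℝ : E →L[ℝ] E →L[ℝ] ℝ) (X ω) w = inner ℝ (X ω) w := rfl
  simp only [map_smul, smul_apply, ContinuousLinearMap.smulRight_apply, smul_eq_mul, h]
  ring

end ExponentialFamily

theorem norm_sub_half_le {d : ℕ} {x : EuclideanSpace ℝ (Fin d)}
    (hx : ∀ i, x i ∈ Set.Icc (0 : ℝ) 1) :
    ‖x - WithLp.toLp 2 fun _ => (1 / 2 : ℝ)‖ ≤ √d / 2 := by
  refine abs_le_of_sq_le_sq' ?_ (by positivity) |>.2
  rw [EuclideanSpace.norm_sq_eq, div_pow, Real.sq_sqrt (Nat.cast_nonneg d)]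
  calc _ ≤ ∑ _i : Fin d, (1 / 4 : ℝ) := Finset.sum_le_sum fun i _ => by
        obtain ⟨h0, h1⟩ := hx i
        simp only [PiLp.sub_apply, Real.norm_eq_abs, sq_abs]
        nlinarith
    _ = _ := by simp; ring

theorem neg_norm_sq_sub_smul_div {E : Type*} [NormedAddCommGroup E] [InnerProductSpace ℝ E]
    (y x c : E) (m : ℝ) {s : ℝ} (hs : s ≠ 0) :
    -‖y - m • x‖ ^ 2 / (2 * s) =
      -‖y - m • c‖ ^ 2 / (2 * s) + inner ℝ (y - m • c) ((m / s) • (x - c)) +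
        -(m ^ 2 * ‖x - c‖ ^ 2) / (2 * s) := by
  have h : y - m • x = (y - m • c) - m • (x - c) := by module
  rw [h, norm_sub_sq_real, norm_smul, inner_smul_right, inner_smul_right, mul_pow,
    Real.norm_eq_abs, sq_abs]
  field_simp
  ring

theorem hasGradientAt_neg_norm_sq_div {E : Type*} [NormedAddCommGroup E] [InnerProductSpace ℝ E]
    [CompleteSpace E] (s : ℝ) (u : E) :
    HasGradientAt (fun u : E => -‖u‖ ^ 2 / (2 * s)) (-s⁻¹ • u) u := by
  rw [hasGradientAt_iff_hasFDerivAt]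
  simp only [div_eq_mul_inv]
  refine ((hasStrictFDerivAt_norm_sq u).hasFDerivAt.fun_neg.mul_const (2 * s)⁻¹).congr_fderiv ?_
  ext w
  simp
  ring

theorem pt_eq_exp_mul_integral (d : ℕ) (p₀ : Measure (EuclideanSpace ℝ (Fin d))) {t : ℝ}
    (ht : 0 < t) (c y : EuclideanSpace ℝ (Fin d)) :
    pt d p₀ t y = (2 * π * (1 - Real.exp (-2 * t))) ^ (-(d : ℝ) / 2) *
      (Real.exp (-‖y - Real.exp (-t) • c‖ ^ 2 / (2 * (1 - Real.exp (-2 * t)))) *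
      ∫ x, Real.exp (inner ℝ (y - Real.exp (-t) • c)
          ((Real.exp (-t) / (1 - Real.exp (-2 * t))) • (x - c))) •
        Real.exp (-(Real.exp (-t) ^ 2 * ‖x - c‖ ^ 2) / (2 * (1 - Real.exp (-2 * t)))) ∂p₀) := by
  have hs : 1 - Real.exp (-2 * t) ≠ 0 := by
    have : Real.exp (-2 * t) < 1 := Real.exp_lt_one_iff.2 (by linarith)
    linarith
  rw [pt, integral_const_mul, ← integral_const_mul (Real.exp _)]
  congr 2
  ext x
  rw [neg_norm_sq_sub_smul_div y x c _ hs, Real.exp_add, Real.exp_add, smul_eq_mul, mul_assoc]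

theorem drift_eq_tiltedMean (d : ℕ) (p₀ : Measure (EuclideanSpace ℝ (Fin d)))
    [IsProbabilityMeasure p₀] {t r : ℝ} (ht : 0 < t) (c : EuclideanSpace ℝ (Fin d))
    (hr : ∀ᵐ x ∂p₀, ‖(Real.exp (-t) / (1 - Real.exp (-2 * t))) • (x - c)‖ ≤ r)
    (hg : Integrable (fun x => Real.exp
      (-(Real.exp (-t) ^ 2 * ‖x - c‖ ^ 2) / (2 * (1 - Real.exp (-2 * t))))) p₀)
    (y : EuclideanSpace ℝ (Fin d)) :
    drift d p₀ t y = y + (2 : ℝ) • (-(1 - Real.exp (-2 * t))⁻¹ • (y - Real.exp (-t) • c) +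
      tiltedMean p₀
        (fun x => Real.exp (-(Real.exp (-t) ^ 2 * ‖x - c‖ ^ 2) / (2 * (1 - Real.exp (-2 * t)))))
        (fun x => (Real.exp (-t) / (1 - Real.exp (-2 * t))) • (x - c))
        (y - Real.exp (-t) • c)) := by
  have hs : 0 < 1 - Real.exp (-2 * t) := by
    have : Real.exp (-2 * t) < 1 := Real.exp_lt_one_iff.2 (by linarith)
    linarith
  have hX : AEStronglyMeasurable
      (fun x => (Real.exp (-t) / (1 - Real.exp (-2 * t))) • (x - c)) p₀ := by
    have h : Continuous fun x => (Real.exp (-t) / (1 - Real.exp (-2 * t))) • (x - c) := by fun_prop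
    exact h.aestronglyMeasurable
  have hlog : ∀ z, Real.log (pt d p₀ t z) = _ := fun z => by
    rw [pt_eq_exp_mul_integral d p₀ ht c z,
      Real.log_mul (by positivity) (mul_pos (Real.exp_pos _)
        (integral_exp_inner_smul_pos hX hr hg (fun x => Real.exp_pos _) _)).ne',
      Real.log_mul (Real.exp_pos _).ne'
        (integral_exp_inner_smul_pos hX hr hg (fun x => Real.exp_pos _) _).ne', Real.log_exp]
  rw [drift, funext hlog]
  congr 2
  refine HasGradientAt.gradient ?_
  have h₁ := hasGradientAt_neg_norm_sq_div (1 - Real.exp (-2 * t)) (y - Real.exp (-t) • c)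
  have h₂ := hasGradientAt_log_integral_exp_inner hX hr hg (fun x => Real.exp_pos _)
    (y - Real.exp (-t) • c)
  rw [hasGradientAt_iff_hasFDerivAt] at h₁ h₂ ⊢
  rw [map_add]
  exact ((h₁.add h₂).comp y ((hasFDerivAt_id y).sub_const _)).const_add _

/-- Under the bounded support assumption, if `0 < T₀ < (log 2)/2`, then for every
`t ≥ T₀` the drift `y ↦ b(t, y)` is Lipschitz on `ℝ^d` with constant at most `2d/T₀²`. -/
theorem drift_lipschitz (d : ℕ) (hd : 1 ≤ d)
    (p₀ : Measure (EuclideanSpace ℝ (Fin d))) [IsProbabilityMeasure p₀]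
    (hsupp : ∀ᵐ y₀ ∂p₀, ∀ i, y₀ i ∈ Set.Icc (0 : ℝ) 1)
    (T₀ : ℝ) (hT₀ : 0 < T₀) (hT₀' : T₀ < Real.log 2 / 2)
    (t : ℝ) (ht : T₀ ≤ t) :
    ∀ y z : EuclideanSpace ℝ (Fin d),
      ‖drift d p₀ t y - drift d p₀ t z‖ ≤ 2 * (d : ℝ) / T₀ ^ 2 * ‖y - z‖ := by
  intro y z
  have ht0 : 0 < t := hT₀.trans_le ht
  have hT1 : 2 * T₀ ≤ 1 := by
    have := Real.log_two_lt_d9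
    linarith
  have hd' : (1 : ℝ) ≤ d := by exact_mod_cast hd
  have hsT : T₀ ≤ 1 - Real.exp (-2 * t) := by
    have h₁ : Real.exp (-2 * t) ≤ Real.exp (-(2 * T₀)) := Real.exp_le_exp.2 (by linarith)
    have h₂ : Real.exp (-(2 * T₀)) ≤ (1 + 2 * T₀)⁻¹ := by
      rw [Real.exp_neg]
      exact inv_anti₀ (by positivity) (by linarith [Real.add_one_le_exp (2 * T₀)])
    have h₃ : (1 + 2 * T₀)⁻¹ ≤ 1 - T₀ := by
      rw [inv_le_iff_one_le_mul₀ (by positivity)]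
      nlinarith
    linarith
  have hs1 : 1 - Real.exp (-2 * t) ≤ 1 := by linarith [Real.exp_pos (-2 * t)]
  have hm1 : Real.exp (-t) ≤ 1 := Real.exp_le_one_iff.2 (by linarith)
  set c : EuclideanSpace ℝ (Fin d) := WithLp.toLp 2 fun _ => (1 / 2 : ℝ)
  have hr : ∀ᵐ x ∂p₀,
      ‖(Real.exp (-t) / (1 - Real.exp (-2 * t))) • (x - c)‖ ≤ T₀⁻¹ * (√d / 2) := by
    filter_upwards [hsupp] with x hx
    rw [norm_smul, Real.norm_of_nonneg (div_nonneg (Real.exp_pos _).le (hT₀.le.trans hsT)),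
      ← one_div]
    exact mul_le_mul (div_le_div₀ zero_le_one hm1 hT₀ hsT) (norm_sub_half_le hx)
      (norm_nonneg _) (by positivity)
  have hg : Integrable (fun x => Real.exp
      (-(Real.exp (-t) ^ 2 * ‖x - c‖ ^ 2) / (2 * (1 - Real.exp (-2 * t))))) p₀ := by
    refine Integrable.of_bound (C := 1) (Continuous.aestronglyMeasurable (by fun_prop))
      (.of_forall fun x => ?_)
    rw [Real.norm_eq_abs, Real.abs_exp]
    refine Real.exp_le_one_iff.2 (div_nonpos_of_nonpos_of_nonneg ?_ ?_)
    · exact neg_nonpos.2 (by positivity)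
    · linarith
  have hX : AEStronglyMeasurable
      (fun x => (Real.exp (-t) / (1 - Real.exp (-2 * t))) • (x - c)) p₀ :=
    Continuous.aestronglyMeasurable (by fun_prop)
  have hlip := norm_tiltedMean_sub_le hX hr hg (fun x => Real.exp_pos _)
    (y - Real.exp (-t) • c) (z - Real.exp (-t) • c)
  rw [sub_sub_sub_cancel_right, mul_pow, div_pow, Real.sq_sqrt (Nat.cast_nonneg d)] at hlip
  rw [drift_eq_tiltedMean d p₀ ht0 c hr hg, drift_eq_tiltedMean d p₀ ht0 c hr hg]
  set G := tiltedMean p₀ _ _ (y - Real.exp (-t) • c)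
  set H := tiltedMean p₀ _ _ (z - Real.exp (-t) • c)
  set s := 1 - Real.exp (-2 * t)
  have hs0 : 0 < s := hT₀.trans_le hsT
  have hcoef : |1 - 2 * s⁻¹| ≤ d / T₀ ^ 2 := by
    have h₁ : 1 ≤ s⁻¹ := (one_le_inv₀ hs0).2 hs1
    have h₂ : s⁻¹ ≤ T₀⁻¹ := inv_anti₀ hT₀ hsT
    have h₃ : 2 * T₀⁻¹ ≤ d / T₀ ^ 2 := by
      rw [le_div_iff₀ (by positivity)]
      field_simp
      linarith
    rw [abs_le]
    constructor <;> linarith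
  calc _ = ‖(1 - 2 * s⁻¹) • (y - z) + (2 : ℝ) • (G - H)‖ := by
        congr 1
        module
    _ ≤ |1 - 2 * s⁻¹| * ‖y - z‖ + 2 * ‖G - H‖ := by
        refine (norm_add_le _ _).trans_eq ?_
        rw [norm_smul, norm_smul, Real.norm_eq_abs, Real.norm_ofNat]
    _ ≤ d / T₀ ^ 2 * ‖y - z‖ + 2 * (2 * (T₀⁻¹ ^ 2 * (d / 2 ^ 2)) * ‖y - z‖) := by gcongr
    _ = 2 * (d : ℝ) / T₀ ^ 2 * ‖y - z‖ := by
        field_simp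
        ring
end

section
/- Under the bounded support assumption, for every t > 0 the drift b(t, ·) is differentiable in y and its Jacobian satisfies ∇_y b(t, y) = (1 − 2/σ_t²) I_d + (2 e^{-2t}/σ_t⁴) · Cov_t(y), where Cov_t(y) is the covariance matrix of the posterior measure π_{t,y}. -/
open MeasureTheory Real

/-- The posterior measure `π_{t,y}(dy₀) ∝ exp(−‖y − μ_t y₀‖²/(2σ_t²)) p₀(dy₀)`,
the conditional law of `Y₀` given `Y_t = y`. -/
noncomputable def posterior (d : ℕ) (p₀ : Measure (EuclideanSpace ℝ (Fin d))) (t : ℝ)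
    (y : EuclideanSpace ℝ (Fin d)) : Measure (EuclideanSpace ℝ (Fin d)) :=
  ((p₀.withDensity fun y₀ => ENNReal.ofReal
      (Real.exp (-‖y - Real.exp (-t) • y₀‖ ^ 2 / (2 * (1 - Real.exp (-2 * t)))))) Set.univ)⁻¹ •
    (p₀.withDensity fun y₀ => ENNReal.ofReal
      (Real.exp (-‖y - Real.exp (-t) • y₀‖ ^ 2 / (2 * (1 - Real.exp (-2 * t))))))

/-- The mean `m_t(y)` of the posterior `π_{t,y}`. -/
noncomputable def postMean (d : ℕ) (p₀ : Measure (EuclideanSpace ℝ (Fin d))) (t : ℝ)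
    (y : EuclideanSpace ℝ (Fin d)) : EuclideanSpace ℝ (Fin d) :=
  ∫ y₀, y₀ ∂(posterior d p₀ t y)

/-- The covariance matrix `Cov_t(y)` of the posterior `π_{t,y}`. -/
noncomputable def postCov (d : ℕ) (p₀ : Measure (EuclideanSpace ℝ (Fin d))) (t : ℝ)
    (y : EuclideanSpace ℝ (Fin d)) : Matrix (Fin d) (Fin d) ℝ :=
  Matrix.of fun i j =>
    ∫ y₀, (y₀ i - postMean d p₀ t y i) * (y₀ j - postMean d p₀ t y j) ∂(posterior d p₀ t y)

section GaussianKernel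

variable {E F : Type*} [NormedAddCommGroup E] [InnerProductSpace ℝ E]
  [NormedAddCommGroup F] [NormedSpace ℝ F]

/-- The unnormalised Gaussian kernel `exp(−‖y − c x‖² / (2 s))`. -/
noncomputable def gaussKernel (c s : ℝ) (y x : E) : ℝ :=
  Real.exp (-‖y - c • x‖ ^ 2 / (2 * s))

lemma gaussKernel_pos (c s : ℝ) (y x : E) : 0 < gaussKernel c s y x := Real.exp_pos _

lemma gaussKernel_le_one (c : ℝ) {s : ℝ} (hs : 0 < s) (y x : E) : gaussKernel c s y x ≤ 1 := by
  refine Real.exp_le_one_iff.2 ?_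
  rw [neg_div]
  exact neg_nonpos.2 (by positivity)

lemma continuous_gaussKernel (c s : ℝ) (y : E) : Continuous (gaussKernel c s y) := by
  unfold gaussKernel
  fun_prop

lemma hasFDerivAt_gaussKernel (c s : ℝ) (y x : E) :
    HasFDerivAt (fun z => gaussKernel c s z x)
      ((-(gaussKernel c s y x / s)) • innerSL ℝ (y - c • x)) y := by
  have h := ((((hasFDerivAt_id y).sub_const (c • x)).norm_sq).neg.mul_const ((2 * s)⁻¹)).exp
  refine h.congr_fderiv ?_
  ext v
  simp [gaussKernel, div_eq_mul_inv]
  ring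

lemma norm_neg_inv_smul_innerSL_smulRight_le {c s B R C : ℝ} (hs : 0 < s) {y x : E} {w : F}
    (hy : ‖y‖ ≤ B) (hx : ‖x‖ ≤ R) (hw : ‖w‖ ≤ C) :
    ‖((-s⁻¹) • innerSL ℝ (y - c • x)).smulRight w‖ ≤ s⁻¹ * (B + |c| * R) * C := by
  have hd : ‖y - c • x‖ ≤ B + |c| * R := by
    refine (norm_sub_le _ _).trans (add_le_add hy ?_)
    rw [norm_smul, Real.norm_eq_abs]
    gcongr
  rw [ContinuousLinearMap.norm_smulRight_apply, norm_smul, norm_neg, norm_inv,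
    Real.norm_of_nonneg hs.le, innerSL_apply_norm]
  gcongr
  exact mul_nonneg (by positivity) ((norm_nonneg _).trans hd)

lemma continuous_neg_inv_smul_innerSL_smulRight (c s : ℝ) (y : E) {f : E → F}
    (hf : Continuous f) :
    Continuous fun x : E => ((-s⁻¹) • innerSL ℝ (y - c • x)).smulRight (f x) := by
  have h : Continuous fun x : E => (-s⁻¹) • innerSL ℝ (y - c • x) := by fun_prop
  exact (ContinuousLinearMap.smulRightL ℝ E F).continuous₂.comp (h.prodMk hf)

variable [MeasurableSpace E] [BorelSpace E] [SecondCountableTopology E]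
  {ν : Measure E} [IsFiniteMeasure ν]

lemma integrable_gaussKernel_smul (c : ℝ) {s : ℝ} (hs : 0 < s) (y : E) {f : E → F}
    (hf : Continuous f) {R : ℝ} (hR : ∀ᵐ x ∂ν, ‖f x‖ ≤ R) :
    Integrable (fun x => gaussKernel c s y x • f x) ν := by
  refine .of_bound ((continuous_gaussKernel c s y).smul hf).aestronglyMeasurable R ?_
  filter_upwards [hR] with x hx
  rw [norm_smul, Real.norm_of_nonneg (gaussKernel_pos c s y x).le]
  exact (mul_le_of_le_one_left (norm_nonneg _) (gaussKernel_le_one c hs y x)).trans hx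

lemma integrable_gaussKernel (c : ℝ) {s : ℝ} (hs : 0 < s) (y : E) :
    Integrable (gaussKernel c s y) ν := by
  simpa using integrable_gaussKernel_smul (ν := ν) c hs y (continuous_const (y := (1 : ℝ)))
    (R := 1) (by simp)

lemma integral_gaussKernel_pos [NeZero ν] (c : ℝ) {s : ℝ} (hs : 0 < s) (y : E) :
    0 < ∫ x, gaussKernel c s y x ∂ν := by
  have hi := integrable_gaussKernel (ν := ν) c hs y
  rw [integral_pos_iff_support_of_nonneg (fun x => (gaussKernel_pos c s y x).le) hi,
    Function.support_eq_univ fun x => (gaussKernel_pos c s y x).ne']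
  exact NeZero.pos _

/-- Differentiation under the integral of a Gaussian-weighted integral against a measure with
bounded support. -/
lemma hasFDerivAt_integral_gaussKernel_smul (c : ℝ) {s : ℝ} (hs : 0 < s) (y : E)
    {f : E → F} (hf : Continuous f) {R C : ℝ}
    (hR : ∀ᵐ x ∂ν, ‖x‖ ≤ R) (hC : ∀ᵐ x ∂ν, ‖f x‖ ≤ C) :
    HasFDerivAt (fun z => ∫ x, gaussKernel c s z x • f x ∂ν)
      (∫ x, gaussKernel c s y x •
        ((-s⁻¹) • innerSL ℝ (y - c • x)).smulRight (f x) ∂ν) y := by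
  refine hasFDerivAt_integral_of_dominated_of_fderiv_le (Metric.ball_mem_nhds y one_pos)
    (F' := fun z x => gaussKernel c s z x • ((-s⁻¹) • innerSL ℝ (z - c • x)).smulRight (f x))
    (bound := fun _ => s⁻¹ * (‖y‖ + 1 + |c| * R) * C)
    (.of_forall fun z => (integrable_gaussKernel_smul c hs z hf hC).aestronglyMeasurable)
    (integrable_gaussKernel_smul c hs y hf hC) ?_ ?_ (integrable_const _) ?_
  · have := secondCountableTopologyEither_of_left E (E →L[ℝ] F)
    exact ((continuous_gaussKernel c s y).smul
      (continuous_neg_inv_smul_innerSL_smulRight c s y hf)).aestronglyMeasurable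
  · filter_upwards [hR, hC] with x hx hfx z hz
    have hz' : ‖z‖ ≤ ‖y‖ + 1 := by
      have := norm_le_norm_add_norm_sub' z y
      have := mem_ball_iff_norm.1 hz
      linarith
    rw [norm_smul, Real.norm_of_nonneg (gaussKernel_pos c s z x).le]
    exact (mul_le_of_le_one_left (norm_nonneg _) (gaussKernel_le_one c hs z x)).trans
      (norm_neg_inv_smul_innerSL_smulRight_le hs hz' hx hfx)
  · refine .of_forall fun x z _ => ?_
    refine ((hasFDerivAt_gaussKernel c s z x).smul_const (f x)).congr_fderiv ?_
    ext v
    simp only [ContinuousLinearMap.smulRight_apply, _root_.smul_apply, smul_smul,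
      smul_eq_mul]
    congr 1
    ring

lemma integral_gaussKernel_fderiv_apply [CompleteSpace F] (c : ℝ) {s : ℝ} (hs : 0 < s) (y v : E)
    {f : E → F} (hf : Continuous f) {R C : ℝ}
    (hR : ∀ᵐ x ∂ν, ‖x‖ ≤ R) (hC : ∀ᵐ x ∂ν, ‖f x‖ ≤ C) :
    (∫ x, gaussKernel c s y x • ((-s⁻¹) • innerSL ℝ (y - c • x)).smulRight (f x) ∂ν) v =
      (-s⁻¹ * inner ℝ y v) • (∫ x, gaussKernel c s y x • f x ∂ν) +
        (c * s⁻¹) • ∫ x, gaussKernel c s y x • (inner ℝ x v • f x) ∂ν := by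
  have hb : ∀ᵐ x ∂ν, ‖((-s⁻¹) • innerSL ℝ (y - c • x)).smulRight (f x)‖ ≤
      s⁻¹ * (‖y‖ + |c| * R) * C := by
    filter_upwards [hR, hC] with x hx hfx
    exact norm_neg_inv_smul_innerSL_smulRight_le hs le_rfl hx hfx
  have hc := continuous_neg_inv_smul_innerSL_smulRight c s y hf
  have hb' : ∀ᵐ x ∂ν, ‖(inner ℝ x v : ℝ) • f x‖ ≤ R * ‖v‖ * C := by
    filter_upwards [hR, hC] with x hx hfx
    rw [norm_smul]
    have h0 : 0 ≤ R := (norm_nonneg _).trans hx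
    gcongr
    exact (norm_inner_le_norm x v).trans (by gcongr)
  rw [ContinuousLinearMap.integral_apply (integrable_gaussKernel_smul c hs y hc hb),
    ← integral_smul, ← integral_smul, ← integral_add]
  · refine integral_congr_ae (.of_forall fun x => ?_)
    simp only [ContinuousLinearMap.smulRight_apply, _root_.smul_apply, smul_smul,
      smul_eq_mul, innerSL_apply_apply, inner_sub_left, inner_smul_left, ← add_smul]
    congr 1
    simp
    ring
  · exact (integrable_gaussKernel_smul c hs y hf hC).smul _
  · exact (integrable_gaussKernel_smul c hs y (by fun_prop) hb').smul _

lemma inner_integral_gaussKernel_smul [CompleteSpace E] (c : ℝ) {s : ℝ} (hs : 0 < s) (y v : E)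
    {R : ℝ} (hR : ∀ᵐ x ∂ν, ‖x‖ ≤ R) :
    inner ℝ (∫ x, gaussKernel c s y x • x ∂ν) v = ∫ x, gaussKernel c s y x * inner ℝ x v ∂ν := by
  rw [real_inner_comm, ← integral_inner (integrable_gaussKernel_smul c hs y continuous_id' hR)]
  simp only [inner_smul_right, real_inner_comm]

end GaussianKernel

/-- The matrix of covariances of the coordinates acts as the covariance operator. -/
lemma sum_integral_sub_mul_sub_mul {d : ℕ} {μ : Measure (EuclideanSpace ℝ (Fin d))}
    [IsProbabilityMeasure μ] {R : ℝ} (hR : ∀ᵐ x ∂μ, ‖x‖ ≤ R)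
    (v : EuclideanSpace ℝ (Fin d)) (i : Fin d) :
    ∑ j, (∫ x, (x i - (∫ x, x ∂μ) i) * (x j - (∫ x, x ∂μ) j) ∂μ) * v j =
      ((∫ x, inner ℝ x v • x ∂μ) - inner ℝ (∫ x, x ∂μ) v • ∫ x, x ∂μ) i := by
  have hcont : ∀ j, Continuous fun x : EuclideanSpace ℝ (Fin d) => x j := fun j => by fun_prop
  have hid : Integrable (fun x => x) μ := .of_bound continuous_id.aestronglyMeasurable R hR
  have hcoord : ∀ f : EuclideanSpace ℝ (Fin d) → EuclideanSpace ℝ (Fin d), Integrable f μ →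
      ∀ j, (∫ x, f x ∂μ) j = ∫ x, f x j ∂μ := fun f hf j =>
    ((EuclideanSpace.proj (𝕜 := ℝ) j).integral_comp_comm hf).symm
  have hLp : ∀ j, MemLp (fun x : EuclideanSpace ℝ (Fin d) => x j) 2 μ := fun j => by
    refine .of_bound (hcont j).aestronglyMeasurable R ?_
    filter_upwards [hR] with x hx
    exact (PiLp.norm_apply_le x j).trans hx
  have hinner : Integrable (fun x => (inner ℝ x v : ℝ) • x) μ := by
    refine .of_bound (by fun_prop) (R * ‖v‖ * R) ?_
    filter_upwards [hR] with x hx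
    rw [norm_smul]
    have h0 : 0 ≤ R := (norm_nonneg _).trans hx
    gcongr
    exact (norm_inner_le_norm x v).trans (by gcongr)
  have hcov : ∀ j, ∫ x, (x i - (∫ x, x ∂μ) i) * (x j - (∫ x, x ∂μ) j) ∂μ =
      (∫ x, x i * x j ∂μ) - (∫ x, x ∂μ) i * (∫ x, x ∂μ) j := fun j => by
    rw [hcoord _ hid, hcoord _ hid]
    exact ProbabilityTheory.covariance_eq_sub (hLp i) (hLp j)
  simp only [hcov]
  simp only [sub_mul, Finset.sum_sub_distrib, PiLp.sub_apply, PiLp.smul_apply, smul_eq_mul]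
  congr 1
  · rw [hcoord _ hinner]
    simp only [← integral_mul_const]
    rw [← integral_finsetSum _ fun j _ => Integrable.mul_const
      (f := fun x : EuclideanSpace ℝ (Fin d) => x i * x j)
      ((hLp i).integrable_mul (hLp j)) (v j)]
    refine integral_congr_ae (.of_forall fun x => ?_)
    simp only [PiLp.inner_apply, PiLp.smul_apply, smul_eq_mul, Finset.sum_mul]
    refine Finset.sum_congr rfl fun j _ => ?_
    simp
    ring
  · simp only [PiLp.inner_apply, Finset.sum_mul]
    refine Finset.sum_congr rfl fun j _ => ?_
    simp
    ring

section Drift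

variable {d : ℕ} {p₀ : Measure (EuclideanSpace ℝ (Fin d))}

lemma one_sub_exp_neg_two_mul_pos {t : ℝ} (ht : 0 < t) : 0 < 1 - Real.exp (-2 * t) := by
  have : Real.exp (-2 * t) < 1 := Real.exp_lt_one_iff.2 (by linarith)
  linarith

lemma ae_norm_le_sqrt_of_ae_mem_Icc (hsupp : ∀ᵐ y₀ ∂p₀, ∀ i, y₀ i ∈ Set.Icc (0 : ℝ) 1) :
    ∀ᵐ x ∂p₀, ‖x‖ ≤ √d := by
  filter_upwards [hsupp] with x hx
  rw [EuclideanSpace.norm_eq]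
  refine Real.sqrt_le_sqrt ?_
  calc ∑ i, ‖x i‖ ^ 2 ≤ ∑ _i : Fin d, (1 : ℝ) := by
        refine Finset.sum_le_sum fun i _ => ?_
        rw [Real.norm_of_nonneg (hx i).1]
        exact pow_le_one₀ (hx i).1 (hx i).2
    _ = d := by simp

lemma posterior_eq_smul_withDensity (t : ℝ) (y : EuclideanSpace ℝ (Fin d)) :
    posterior d p₀ t y =
      ((p₀.withDensity fun x => ENNReal.ofReal
          (gaussKernel (Real.exp (-t)) (1 - Real.exp (-2 * t)) y x)) Set.univ)⁻¹ •
        (p₀.withDensity fun x => ENNReal.ofReal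
          (gaussKernel (Real.exp (-t)) (1 - Real.exp (-2 * t)) y x)) := rfl

lemma posterior_absolutelyContinuous (t : ℝ) (y : EuclideanSpace ℝ (Fin d)) :
    posterior d p₀ t y ≪ p₀ :=
  Measure.smul_absolutelyContinuous.trans (withDensity_absolutelyContinuous _ _)

lemma isProbabilityMeasure_posterior [IsProbabilityMeasure p₀] {t : ℝ} (ht : 0 < t)
    (y : EuclideanSpace ℝ (Fin d)) : IsProbabilityMeasure (posterior d p₀ t y) := by
  have hi := integrable_gaussKernel (ν := p₀) (Real.exp (-t)) (one_sub_exp_neg_two_mul_pos ht) y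
  have := isFiniteMeasure_withDensity_ofReal hi.2
  have : NeZero (p₀.withDensity fun x => ENNReal.ofReal
      (gaussKernel (Real.exp (-t)) (1 - Real.exp (-2 * t)) y x)) := by
    refine ⟨fun h => NeZero.ne p₀ ?_⟩
    refine Measure.measure_univ_eq_zero.1 ?_
    have := (withDensity_eq_zero_iff
      (continuous_gaussKernel _ _ y).measurable.ennreal_ofReal.aemeasurable).1 h
    simp [Filter.EventuallyEq, ae_iff, gaussKernel_pos] at this
  rw [posterior_eq_smul_withDensity]
  infer_instance

lemma integral_posterior [IsProbabilityMeasure p₀] {F : Type*} [NormedAddCommGroup F]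
    [NormedSpace ℝ F] {t : ℝ} (ht : 0 < t) (y : EuclideanSpace ℝ (Fin d))
    (f : EuclideanSpace ℝ (Fin d) → F) :
    ∫ x, f x ∂(posterior d p₀ t y) =
      (∫ x, gaussKernel (Real.exp (-t)) (1 - Real.exp (-2 * t)) y x ∂p₀)⁻¹ •
        ∫ x, gaussKernel (Real.exp (-t)) (1 - Real.exp (-2 * t)) y x • f x ∂p₀ := by
  set c := Real.exp (-t)
  set s := 1 - Real.exp (-2 * t)
  have hs : 0 < s := one_sub_exp_neg_two_mul_pos ht
  have hi := integrable_gaussKernel (ν := p₀) c hs y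
  rw [posterior_eq_smul_withDensity, integral_smul_measure, withDensity_apply _ MeasurableSet.univ,
    Measure.restrict_univ, ← ofReal_integral_eq_lintegral_ofReal hi
      (.of_forall fun x => (gaussKernel_pos c s y x).le), ENNReal.toReal_inv,
    ENNReal.toReal_ofReal (integral_nonneg fun x => (gaussKernel_pos c s y x).le),
    integral_withDensity_eq_integral_toReal_smul
      (continuous_gaussKernel c s y).measurable.ennreal_ofReal (.of_forall fun _ => by simp)]
  simp only [ENNReal.toReal_ofReal (gaussKernel_pos c s y _).le]

/-- Tweedie's formula for the drift. -/
lemma drift_eq_smul_add_smul_postMean [IsProbabilityMeasure p₀]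
    (hsupp : ∀ᵐ y₀ ∂p₀, ∀ i, y₀ i ∈ Set.Icc (0 : ℝ) 1) {t : ℝ} (ht : 0 < t)
    (y : EuclideanSpace ℝ (Fin d)) :
    drift d p₀ t y = (1 - 2 / (1 - Real.exp (-2 * t))) • y +
      (2 * Real.exp (-t) / (1 - Real.exp (-2 * t))) • postMean d p₀ t y := by
  rw [postMean, integral_posterior ht]
  set c := Real.exp (-t)
  set s := 1 - Real.exp (-2 * t)
  have hs : 0 < s := one_sub_exp_neg_two_mul_pos ht
  have hR := ae_norm_le_sqrt_of_ae_mem_Icc hsupp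
  have h1 : ∀ᵐ _x ∂p₀, ‖(1 : ℝ)‖ ≤ 1 := by simp
  have hZ := hasFDerivAt_integral_gaussKernel_smul c hs y continuous_const hR h1
  have hZv := fun v => integral_gaussKernel_fderiv_apply c hs y v continuous_const hR h1
  have hpos := integral_gaussKernel_pos (ν := p₀) c hs y
  set K : ℝ := (2 * π * s) ^ (-(d : ℝ) / 2)
  have hK : 0 < K := by positivity
  have hpt : pt d p₀ t = fun z => K * ∫ x, gaussKernel c s z x • (1 : ℝ) ∂p₀ := by
    funext z
    rw [← integral_const_mul]
    simp only [smul_eq_mul, mul_one]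
    rfl
  have hlog := (hZ.const_mul K).log (by simpa using ⟨hK.ne', hpos.ne'⟩)
  have hgrad : gradient (fun z => Real.log (pt d p₀ t z)) y = (-s⁻¹) • y +
      (c * s⁻¹) • (∫ x, gaussKernel c s y x ∂p₀)⁻¹ • ∫ x, gaussKernel c s y x • x ∂p₀ := by
    refine HasGradientAt.gradient ?_
    rw [hasGradientAt_iff_hasFDerivAt, hpt]
    refine hlog.congr_fderiv ?_
    ext v
    have hinner := inner_integral_gaussKernel_smul c hs y v hR
    simp only [_root_.smul_apply, hZv, InnerProductSpace.toDual_apply_apply,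
      inner_add_left, real_inner_smul_left, hinner, smul_eq_mul, mul_one]
    field_simp
  rw [drift, hgrad]
  module

lemma sum_smul_one_add_smul_apply (a b : ℝ) (A : Matrix (Fin d) (Fin d) ℝ)
    (v : EuclideanSpace ℝ (Fin d)) (i : Fin d) :
    ∑ j, (a • (1 : Matrix (Fin d) (Fin d) ℝ) + b • A) i j * v j =
      a * v i + b * ∑ j, A i j * v j := by
  simp [add_mul, Finset.sum_add_distrib, Matrix.one_apply, Finset.mul_sum, mul_assoc]

lemma sum_postCov_mul [IsProbabilityMeasure p₀]
    (hsupp : ∀ᵐ y₀ ∂p₀, ∀ i, y₀ i ∈ Set.Icc (0 : ℝ) 1) {t : ℝ} (ht : 0 < t)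
    (y v : EuclideanSpace ℝ (Fin d)) (i : Fin d) :
    ∑ j, postCov d p₀ t y i j * v j =
      ((∫ x, inner ℝ x v • x ∂(posterior d p₀ t y)) -
        inner ℝ (postMean d p₀ t y) v • postMean d p₀ t y) i := by
  have := isProbabilityMeasure_posterior (p₀ := p₀) ht y
  exact sum_integral_sub_mul_sub_mul ((posterior_absolutelyContinuous t y).ae_le
    (ae_norm_le_sqrt_of_ae_mem_Icc hsupp)) v i

/-- The derivative of the posterior mean is the posterior covariance, up to scaling. -/
lemma hasFDerivAt_postMean [IsProbabilityMeasure p₀]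
    (hsupp : ∀ᵐ y₀ ∂p₀, ∀ i, y₀ i ∈ Set.Icc (0 : ℝ) 1) {t : ℝ} (ht : 0 < t)
    (y : EuclideanSpace ℝ (Fin d)) :
    ∃ L : EuclideanSpace ℝ (Fin d) →L[ℝ] EuclideanSpace ℝ (Fin d),
      HasFDerivAt (postMean d p₀ t) L y ∧
      ∀ v, L v = (Real.exp (-t) / (1 - Real.exp (-2 * t))) •
        ((∫ x, inner ℝ x v • x ∂(posterior d p₀ t y)) -
          inner ℝ (postMean d p₀ t y) v • postMean d p₀ t y) := by
  have hmean : postMean d p₀ t = fun z => _ := funext fun z => integral_posterior ht z _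
  simp only [hmean, integral_posterior ht]
  set c := Real.exp (-t)
  set s := 1 - Real.exp (-2 * t)
  have hs : 0 < s := one_sub_exp_neg_two_mul_pos ht
  have hR := ae_norm_le_sqrt_of_ae_mem_Icc hsupp
  have h1 : ∀ᵐ _x ∂p₀, ‖(1 : ℝ)‖ ≤ 1 := by simp
  have hZ := hasFDerivAt_integral_gaussKernel_smul c hs y continuous_const hR h1
  have hZv := fun v => integral_gaussKernel_fderiv_apply c hs y v continuous_const hR h1
  have hM := hasFDerivAt_integral_gaussKernel_smul c hs y continuous_id' hR hR
  have hMv := fun v => integral_gaussKernel_fderiv_apply c hs y v continuous_id' hR hR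
  have hpos := integral_gaussKernel_pos (ν := p₀) c hs y
  simp only [smul_eq_mul, mul_one] at hZ
  refine ⟨_, ((hasFDerivAt_inv hpos.ne').comp y hZ).smul hM, fun v => ?_⟩
  have hinner := inner_integral_gaussKernel_smul c hs y v hR
  simp only [_root_.add_apply, _root_.smul_apply,
    ContinuousLinearMap.smulRight_apply, ContinuousLinearMap.comp_apply, Function.comp_apply,
    ContinuousLinearMap.toSpanSingleton_apply,
    hZv, hMv, real_inner_smul_left, hinner, smul_eq_mul, mul_one]
  set Z := ∫ x, gaussKernel c s y x ∂p₀
  match_scalars <;> field_simp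
  ring

end Drift

/-- Under the bounded support assumption, for every `t > 0` the drift `b(t, ·)` is
differentiable in `y` and its Jacobian satisfies
`∇_y b(t, y) = (1 − 2/σ_t²) I_d + (2 e^{-2t}/σ_t⁴) Cov_t(y)`. -/
theorem drift_jacobian (d : ℕ) (hd : 1 ≤ d)
    (p₀ : Measure (EuclideanSpace ℝ (Fin d))) [IsProbabilityMeasure p₀]
    (hsupp : ∀ᵐ y₀ ∂p₀, ∀ i, y₀ i ∈ Set.Icc (0 : ℝ) 1)
    (t : ℝ) (ht : 0 < t) :
    ∀ y : EuclideanSpace ℝ (Fin d),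
      DifferentiableAt ℝ (drift d p₀ t) y ∧
      ∀ (v : EuclideanSpace ℝ (Fin d)) (i : Fin d),
        fderiv ℝ (drift d p₀ t) y v i =
          ∑ j, ((1 - 2 / (1 - Real.exp (-2 * t))) • (1 : Matrix (Fin d) (Fin d) ℝ) +
              (2 * Real.exp (-2 * t) / (1 - Real.exp (-2 * t)) ^ 2) • postCov d p₀ t y) i j
            * v j := by
  intro y
  obtain ⟨L, hL, hLv⟩ := hasFDerivAt_postMean hsupp ht y
  have hb : HasFDerivAt (drift d p₀ t) _ y :=
    (((hasFDerivAt_id y).const_smul (1 - 2 / (1 - Real.exp (-2 * t)))).add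
      (hL.const_smul (2 * Real.exp (-t) / (1 - Real.exp (-2 * t))))).congr_of_eventuallyEq
      (.of_forall fun z => drift_eq_smul_add_smul_postMean hsupp ht z)
  refine ⟨hb.differentiableAt, fun v i => ?_⟩
  have hexp : Real.exp (-2 * t) = Real.exp (-t) ^ 2 := by
    rw [← Real.exp_nat_mul]
    congr 1
    push_cast
    ring
  rw [hb.fderiv, sum_smul_one_add_smul_apply, sum_postCov_mul hsupp ht]
  simp only [_root_.add_apply, _root_.smul_apply, hLv, smul_smul,
    ContinuousLinearMap.id_apply, PiLp.add_apply, PiLp.smul_apply, smul_eq_mul]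
  congr 2
  rw [hexp, div_mul_div_comm]
  ring
end

section
/- Under the bounded support assumption, for every t > 0 the fourth moment of the drift along the forward process satisfies E ‖ b(t, Y_t) ‖⁴ ≤ (136 d² + 128 d) / (1 − e^{-t})⁴. -/
open MeasureTheory Real ProbabilityTheory

theorem integral_Ioi_pow_mul_exp_neg_sq_div_two (n : ℕ) :
    ∫ x in Set.Ioi (0 : ℝ), x ^ n * Real.exp (-x ^ 2 / 2) =
      (1 / 2 : ℝ) ^ (-((n : ℝ) + 1) / 2) * (1 / 2) * Real.Gamma (((n : ℝ) + 1) / 2) := by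
  rw [← integral_rpow_mul_exp_neg_mul_rpow (p := 2) (q := n) (b := 1 / 2) two_pos
    (by linarith [n.cast_nonneg (α := ℝ)]) (by norm_num)]
  congr 1 with x
  rw [Real.rpow_natCast, Real.rpow_two]
  ring_nf

theorem integrableOn_Ioi_pow_mul_exp_neg_sq_div_two (n : ℕ) :
    IntegrableOn (fun x : ℝ => x ^ n * Real.exp (-x ^ 2 / 2)) (Set.Ioi 0) := by
  have h := integrableOn_rpow_mul_exp_neg_mul_sq (b := 1 / 2) (by norm_num) (s := n)
    (by linarith [n.cast_nonneg (α := ℝ)])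
  refine h.congr_fun (fun x _ => ?_) measurableSet_Ioi
  simp only [Real.rpow_natCast]
  ring_nf

theorem integral_Ioi_pow_add_four_mul_exp_neg_sq_div_two (n : ℕ) :
    ∫ x in Set.Ioi (0 : ℝ), x ^ (n + 4) * Real.exp (-x ^ 2 / 2) =
      ((n : ℝ) + 1) * (n + 3) * ∫ x in Set.Ioi (0 : ℝ), x ^ n * Real.exp (-x ^ 2 / 2) := by
  simp only [integral_Ioi_pow_mul_exp_neg_sq_div_two]
  have hn : (0 : ℝ) ≤ n := n.cast_nonneg
  have hG : Real.Gamma ((((n + 4 : ℕ) : ℝ) + 1) / 2) =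
      (((n : ℝ) + 1) / 2 + 1) * ((((n : ℝ) + 1) / 2) * Real.Gamma (((n : ℝ) + 1) / 2)) := by
    rw [← Real.Gamma_add_one (by positivity), ← Real.Gamma_add_one (by positivity)]
    congr 1
    push_cast
    ring
  have hP : (1 / 2 : ℝ) ^ (-(((n + 4 : ℕ) : ℝ) + 1) / 2) =
      (1 / 2 : ℝ) ^ (-((n : ℝ) + 1) / 2) * 4 := by
    rw [show -(((n + 4 : ℕ) : ℝ) + 1) / 2 = -((n : ℝ) + 1) / 2 + (-2 : ℤ) by push_cast; ring,
      Real.rpow_add (by norm_num), Real.rpow_intCast]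
    norm_num
  rw [hG, hP]
  ring

theorem integral_stdGaussian (d : ℕ) (f : EuclideanSpace ℝ (Fin d) → ℝ) :
    ∫ z, f z ∂(stdGaussian d) =
      (2 * π) ^ (-(d : ℝ) / 2) * ∫ z, f z * Real.exp (-‖z‖ ^ 2 / 2) := by
  rw [_root_.stdGaussian, integral_withDensity_eq_integral_toReal_smul (by fun_prop) (by simp),
    ← integral_const_mul]
  congr 1 with z
  rw [ENNReal.toReal_ofReal (by positivity), smul_eq_mul]
  ring

theorem integrable_norm_pow_four_stdGaussian (d : ℕ) (hd : 1 ≤ d) :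
    Integrable (fun z => ‖z‖ ^ 4) (stdGaussian d) := by
  have : Nonempty (Fin d) := ⟨⟨0, hd⟩⟩
  rw [_root_.stdGaussian, integrable_withDensity_iff (by fun_prop) (by simp)]
  have h : Integrable (fun z : EuclideanSpace ℝ (Fin d) => ‖z‖ ^ 4 * Real.exp (-‖z‖ ^ 2 / 2)) := by
    refine (integrable_fun_norm_addHaar (volume : Measure (EuclideanSpace ℝ (Fin d)))
      (f := fun r => r ^ 4 * Real.exp (-r ^ 2 / 2))).2 ?_
    refine (integrableOn_Ioi_pow_mul_exp_neg_sq_div_two (d - 1 + 4)).congr_fun (fun x _ => ?_)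
      measurableSet_Ioi
    simp only [finrank_euclideanSpace_fin, smul_eq_mul]
    ring
  refine (h.const_mul ((2 * π) ^ (-(d : ℝ) / 2))).congr (ae_of_all _ fun z => ?_)
  simp only
  rw [ENNReal.toReal_ofReal (by positivity)]
  ring

theorem integral_norm_pow_four_stdGaussian (d : ℕ) (hd : 1 ≤ d)
    [IsProbabilityMeasure (stdGaussian d)] :
    ∫ z, ‖z‖ ^ 4 ∂(stdGaussian d) = (d : ℝ) * (d + 2) := by
  have : Nonempty (Fin d) := ⟨⟨0, hd⟩⟩
  have hone : ∫ _, (1 : ℝ) ∂(stdGaussian d) = 1 := by simp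
  rw [integral_stdGaussian] at hone ⊢
  have h4 := integral_fun_norm_addHaar (volume : Measure (EuclideanSpace ℝ (Fin d)))
    (fun r => r ^ 4 * Real.exp (-r ^ 2 / 2))
  have h0 := integral_fun_norm_addHaar (volume : Measure (EuclideanSpace ℝ (Fin d)))
    (fun r => 1 * Real.exp (-r ^ 2 / 2))
  have hJ := integral_Ioi_pow_add_four_mul_exp_neg_sq_div_two (d - 1)
  simp only [pow_add, mul_assoc, Nat.cast_sub hd] at hJ
  simp only [finrank_euclideanSpace_fin, smul_eq_mul, nsmul_eq_mul, one_mul] at h4 h0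
  simp only [one_mul] at hone
  rw [h4, hJ]
  rw [h0] at hone
  push_cast
  linear_combination ((d : ℝ) * (d + 2)) * hone

theorem EuclideanSpace.norm_sq_le_of_abs_le_one {d : ℕ} {x : EuclideanSpace ℝ (Fin d)}
    (hx : ∀ i, |x i| ≤ 1) : ‖x‖ ^ 2 ≤ d := by
  rw [EuclideanSpace.norm_sq_eq]
  calc ∑ i, ‖x i‖ ^ 2 ≤ ∑ _i : Fin d, (1 : ℝ) :=
        Finset.sum_le_sum fun i _ => pow_le_one₀ (norm_nonneg _) (hx i)
    _ = d := by simp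

theorem exists_hasGradientAt_log_pt {d : ℕ} (ν : Measure (EuclideanSpace ℝ (Fin d)))
    [IsProbabilityMeasure ν] (hν : ∀ᵐ x ∂ν, ∀ i, x i ∈ Set.Icc (0 : ℝ) 1) {t : ℝ} (ht : 0 < t)
    (y : EuclideanSpace ℝ (Fin d)) :
    ∃ D : EuclideanSpace ℝ (Fin d), (∀ i, D i ∈ Set.Icc (0 : ℝ) 1) ∧
      HasGradientAt (fun z => Real.log (pt d ν t z))
        (-(1 - Real.exp (-2 * t))⁻¹ • (y - Real.exp (-t) • D)) y := by
  have hv : 0 < 1 - Real.exp (-2 * t) := by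
    have : Real.exp (-2 * t) < 1 := Real.exp_lt_one_iff.2 (by linarith)
    linarith
  set v := 1 - Real.exp (-2 * t)
  set m := Real.exp (-t)
  have hm0 : 0 < m := Real.exp_pos _
  have hm1 : m ≤ 1 := Real.exp_le_one_iff.2 (by linarith)
  set C := (2 * π * v) ^ (-(d : ℝ) / 2)
  have hC0 : 0 < C := by positivity
  let F : EuclideanSpace ℝ (Fin d) → EuclideanSpace ℝ (Fin d) → ℝ := fun x a =>
    C * Real.exp (-‖x - m • a‖ ^ 2 / (2 * v))
  let F' : EuclideanSpace ℝ (Fin d) → EuclideanSpace ℝ (Fin d) →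
      EuclideanSpace ℝ (Fin d) →L[ℝ] ℝ := fun x a =>
    (-v⁻¹ * F x a) • innerSL ℝ (x - m • a)
  have hFpos : ∀ x a, 0 < F x a := fun x a => by positivity
  have hFle : ∀ x a, F x a ≤ C := fun x a => by
    refine mul_le_of_le_one_right hC0.le (Real.exp_le_one_iff.2 ?_)
    rw [neg_div]
    exact neg_nonpos.2 (by positivity)
  have hFcont : ∀ x, Continuous (F x) := fun x => by fun_prop
  have hFint : ∀ x, Integrable (F x) ν := fun x =>
    (integrable_const C).mono' (hFcont x).aestronglyMeasurable
      (ae_of_all _ fun a => by rw [Real.norm_of_nonneg (hFpos x a).le]; exact hFle x a)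
  have hnorm : ∀ᵐ a ∂ν, ‖a‖ ≤ √d := by
    filter_upwards [hν] with a ha
    refine Real.le_sqrt_of_sq_le (EuclideanSpace.norm_sq_le_of_abs_le_one fun i => ?_)
    rw [abs_of_nonneg (ha i).1]
    exact (ha i).2
  have hF'cont : Continuous (F' y) := by
    have : Continuous fun a : EuclideanSpace ℝ (Fin d) => innerSL ℝ (y - m • a) :=
      (innerSL ℝ).continuous.comp (by fun_prop)
    exact (continuous_const.mul (hFcont y)).smul this
  have hbound : ∀ᵐ a ∂ν, ∀ x ∈ Metric.ball y 1, ‖F' x a‖ ≤ v⁻¹ * C * (‖y‖ + 1 + √d) := by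
    filter_upwards [hnorm] with a ha x hx
    have h1 : ‖x - m • a‖ ≤ ‖y‖ + 1 + √d := by
      have hx' : ‖x‖ ≤ ‖y‖ + 1 := by
        have := norm_le_norm_add_norm_sub' x y
        rw [Metric.mem_ball, dist_eq_norm] at hx
        linarith
      have hma : ‖m • a‖ ≤ √d := by
        rw [norm_smul, Real.norm_of_nonneg hm0.le]
        exact (mul_le_of_le_one_left (norm_nonneg _) hm1).trans ha
      linarith [norm_sub_le x (m • a)]
    have h2 : ‖-v⁻¹ * F x a‖ ≤ v⁻¹ * C := by
      rw [norm_mul, norm_neg, Real.norm_of_nonneg (inv_pos.2 hv).le,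
        Real.norm_of_nonneg (hFpos x a).le]
      gcongr
      exact hFle x a
    rw [norm_smul, innerSL_apply_norm]
    gcongr
  have hdiff : ∀ᵐ a ∂ν, ∀ x ∈ Metric.ball y 1, HasFDerivAt (F · a) (F' x a) x := by
    refine ae_of_all _ fun a x _ => ?_
    have h := ((((hasFDerivAt_id x).sub_const (m • a)).norm_sq.neg.mul_const
      (2 * v)⁻¹).exp).const_mul C
    simp only [← div_eq_mul_inv] at h
    refine h.congr_fderiv ?_
    ext u
    simp [F', F]
    field_simp
  have hder := hasFDerivAt_integral_of_dominated_of_fderiv_le (μ := ν)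
    (Metric.ball_mem_nhds y one_pos) (.of_forall fun x => (hFcont x).aestronglyMeasurable)
    (hFint y) hF'cont.aestronglyMeasurable hbound (integrable_const _) hdiff
  set p := ∫ a, F y a ∂ν with hp
  have hp0 : 0 < p := (integral_pos_iff_support_of_nonneg (fun a => (hFpos y a).le) (hFint y)).2 (by
    rw [Function.support_eq_univ fun a => (hFpos y a).ne']
    simp)
  have hF'int : Integrable (F' y) ν :=
    (integrable_const _).mono' hF'cont.aestronglyMeasurable
      (hbound.mono fun a ha => ha y (Metric.mem_ball_self one_pos))
  have hGint : Integrable (fun a => F y a • a) ν := by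
    refine (integrable_const (C * √d)).mono'
      ((hFcont y).smul continuous_id).aestronglyMeasurable ?_
    filter_upwards [hnorm] with a ha
    rw [norm_smul, Real.norm_of_nonneg (hFpos y a).le]
    gcongr
    exact hFle y a
  refine ⟨p⁻¹ • ∫ a, F y a • a ∂ν, fun i => ?_, ?_⟩
  · have hi : (∫ a, F y a • a ∂ν) i = ∫ a, F y a * a i ∂ν := by
      have := (EuclideanSpace.proj (𝕜 := ℝ) i).integral_comp_comm hGint
      simpa using this.symm
    have hiint : Integrable (fun a => F y a * a i) ν := by
      simpa using (EuclideanSpace.proj (𝕜 := ℝ) i).integrable_comp hGint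
    rw [PiLp.smul_apply, hi, smul_eq_mul]
    constructor
    · refine mul_nonneg (inv_pos.2 hp0).le (integral_nonneg_of_ae ?_)
      filter_upwards [hν] with a ha
      exact mul_nonneg (hFpos y a).le (ha i).1
    · rw [inv_mul_le_one₀ hp0]
      refine integral_mono_ae hiint (hFint y) ?_
      filter_upwards [hν] with a ha
      exact mul_le_of_le_one_right (hFpos y a).le (ha i).2
  · rw [hasGradientAt_iff_hasFDerivAt]
    have hlog := hder.log hp0.ne'
    refine hlog.congr_fderiv ?_
    ext u
    have hinner : ∫ a, inner ℝ (F y a • a) u ∂ν = inner ℝ (∫ a, F y a • a ∂ν) u := by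
      rw [real_inner_comm, ← integral_inner hGint]
      simp only [real_inner_comm]
    have hiint : Integrable (fun a => inner ℝ (F y a • a) u) ν := hGint.inner_const u
    rw [_root_.smul_apply, ContinuousLinearMap.integral_apply hF'int,
      InnerProductSpace.toDual_apply_apply]
    have : ∀ a, F' y a u = -v⁻¹ * inner ℝ y u * F y a + v⁻¹ * m * inner ℝ (F y a • a) u := by
      intro a
      simp only [F', _root_.smul_apply, innerSL_apply_apply, inner_sub_left,
        real_inner_smul_left, smul_eq_mul]
      ring
    simp only [this]
    rw [integral_add ((hFint y).const_mul _) (hiint.const_mul _),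
      integral_const_mul (-v⁻¹ * inner ℝ y u), integral_const_mul (v⁻¹ * m), hinner, ← hp]
    simp only [inner_sub_left, real_inner_smul_left, smul_eq_mul]
    field_simp
    ring

theorem norm_drift_pow_four_le {d : ℕ} (ν : Measure (EuclideanSpace ℝ (Fin d)))
    [IsProbabilityMeasure ν] (hν : ∀ᵐ x ∂ν, ∀ i, x i ∈ Set.Icc (0 : ℝ) 1) {t : ℝ} (ht : 0 < t)
    {a : EuclideanSpace ℝ (Fin d)} (ha : ∀ i, a i ∈ Set.Icc (0 : ℝ) 1)
    (z : EuclideanSpace ℝ (Fin d)) :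
    ‖drift d ν t (Real.exp (-t) • a + √(1 - Real.exp (-2 * t)) • z)‖ ^ 4 ≤
      8 * ((d : ℝ) ^ 2 + ‖z‖ ^ 4) / (1 - Real.exp (-t)) ^ 4 := by
  obtain ⟨D, hD, hgrad⟩ := exists_hasGradientAt_log_pt ν hν ht
    (Real.exp (-t) • a + √(1 - Real.exp (-2 * t)) • z)
  rw [drift, hgrad.gradient]
  have hsq : Real.exp (-2 * t) = Real.exp (-t) ^ 2 := by
    rw [← Real.exp_nat_mul]
    push_cast
    ring_nf
  have hm1 : Real.exp (-t) < 1 := Real.exp_lt_one_iff.2 (by linarith)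
  have hm0 : 0 < Real.exp (-t) := Real.exp_pos _
  rw [hsq]
  generalize Real.exp (-t) = m at hm0 hm1 ⊢
  have hv : 0 < 1 - m ^ 2 := by nlinarith
  set s := √(1 - m ^ 2)
  have hs2 : s ^ 2 = 1 - m ^ 2 := Real.sq_sqrt hv.le
  set w : EuclideanSpace ℝ (Fin d) :=
    (2 * m / (1 + m)) • D - ((1 + m ^ 2) * m / (1 + m)) • a with hw
  set c : ℝ := (1 + m ^ 2) * s / (1 + m) with hc
  have hkey : m • a + s • z + (2 : ℝ) • (-(1 - m ^ 2)⁻¹ • (m • a + s • z - m • D)) =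
      (1 - m)⁻¹ • (w - c • z) := by
    ext i
    have h1 : 1 - m ≠ 0 := by linarith
    have h2 : 1 + m ≠ 0 := by linarith
    have h3 : 1 - m ^ 2 = (1 - m) * (1 + m) := by ring
    simp only [hw, hc, h3, PiLp.add_apply, PiLp.sub_apply, PiLp.smul_apply, smul_eq_mul]
    field_simp
    ring
  have hwn : ‖w‖ ^ 2 ≤ d := by
    refine EuclideanSpace.norm_sq_le_of_abs_le_one fun i => ?_
    have hA0 : 0 ≤ 2 * m / (1 + m) := by positivity
    have hA1 : 2 * m / (1 + m) ≤ 1 := by rw [div_le_one (by linarith)]; linarith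
    have hB0 : 0 ≤ (1 + m ^ 2) * m / (1 + m) := by positivity
    have hB1 : (1 + m ^ 2) * m / (1 + m) ≤ 1 := by
      rw [div_le_one (by linarith)]
      nlinarith [pow_le_one₀ hm0.le hm1.le (n := 3)]
    have hDi := hD i
    have hai := ha i
    have e1 := mul_nonneg hA0 hDi.1
    have e2 := mul_nonneg hB0 hai.1
    have e3 := mul_le_one₀ hA1 hDi.1 hDi.2
    have e4 := mul_le_one₀ hB1 hai.1 hai.2
    simp only [hw, PiLp.sub_apply, PiLp.smul_apply, smul_eq_mul]
    rw [abs_le]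
    constructor <;> linarith
  have hc0 : 0 ≤ c := by positivity
  have hc1 : c ≤ 1 := by
    refine (sq_le_one_iff₀ hc0).1 ?_
    rw [hc, div_pow, mul_pow, hs2, div_le_one (by positivity)]
    have hpoly : (1 + m ^ 2) ^ 2 * (1 - m) ≤ 1 + m := by
      have h5 := pow_nonneg hm0.le 5
      have h3 := mul_nonneg (pow_nonneg hm0.le 3) (sub_nonneg.2 hm1.le)
      have h2 := mul_nonneg hm0.le (sub_nonneg.2 hm1.le)
      nlinarith [pow_nonneg hm0.le 3]
    nlinarith
  have hczn : ‖c • z‖ ≤ ‖z‖ := by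
    rw [norm_smul, Real.norm_of_nonneg hc0]
    exact mul_le_of_le_one_left (norm_nonneg _) hc1
  have hfour : ‖w - c • z‖ ^ 4 ≤ 8 * ((d : ℝ) ^ 2 + ‖z‖ ^ 4) := by
    calc ‖w - c • z‖ ^ 4 ≤ (‖w‖ + ‖z‖) ^ 4 := by
          gcongr
          exact (norm_sub_le _ _).trans (by gcongr)
      _ ≤ 2 ^ 3 * (‖w‖ ^ 4 + ‖z‖ ^ 4) := add_pow_le (norm_nonneg _) (norm_nonneg _) 4
      _ = 8 * ((‖w‖ ^ 2) ^ 2 + ‖z‖ ^ 4) := by ring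
      _ ≤ 8 * ((d : ℝ) ^ 2 + ‖z‖ ^ 4) := by gcongr
  rw [hkey, norm_smul, mul_pow, norm_inv, Real.norm_of_nonneg (by linarith : 0 ≤ 1 - m), inv_pow,
    ← div_eq_inv_mul]
  gcongr

/-- Under the bounded support assumption, for every `t > 0` the fourth moment of the
drift along the forward process satisfies
`E‖b(t, Y_t)‖⁴ ≤ (136 d² + 128 d)/(1 − e^{-t})⁴`. -/
theorem fourth_moment_drift (d : ℕ) (hd : 1 ≤ d)
    {Ω : Type*} [MeasurableSpace Ω] (P : Measure Ω) [IsProbabilityMeasure P]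
    (Y₀ Z : Ω → EuclideanSpace ℝ (Fin d)) (hY₀ : Measurable Y₀) (hZ : Measurable Z)
    (hsupp : ∀ᵐ ω ∂P, ∀ i, Y₀ ω i ∈ Set.Icc (0 : ℝ) 1)
    (hZlaw : Measure.map Z P = stdGaussian d)
    (hindep : IndepFun Y₀ Z P)
    (t : ℝ) (ht : 0 < t) :
    (∫ ω, ‖drift d (Measure.map Y₀ P) t
        (Real.exp (-t) • Y₀ ω + Real.sqrt (1 - Real.exp (-2 * t)) • Z ω)‖ ^ 4 ∂P) ≤
      (136 * (d : ℝ) ^ 2 + 128 * (d : ℝ)) / (1 - Real.exp (-t)) ^ 4 := by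
  have hν : ∀ᵐ x ∂(Measure.map Y₀ P), ∀ i, x i ∈ Set.Icc (0 : ℝ) 1 := by
    rw [ae_map_iff hY₀.aemeasurable]
    · exact hsupp
    · simp only [Set.ofPred_forall]
      exact MeasurableSet.iInter fun i =>
        measurableSet_Icc.preimage (EuclideanSpace.proj (𝕜 := ℝ) i).continuous.measurable
  have := Measure.isProbabilityMeasure_map (μ := P) hY₀.aemeasurable
  have : IsProbabilityMeasure (stdGaussian d) :=
    hZlaw ▸ Measure.isProbabilityMeasure_map hZ.aemeasurable
  have hZint : Integrable (fun ω => ‖Z ω‖ ^ 4) P := by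
    have h := integrable_norm_pow_four_stdGaussian d hd
    rw [← hZlaw] at h
    exact h.comp_measurable hZ
  have hZ4 : ∫ ω, ‖Z ω‖ ^ 4 ∂P = (d : ℝ) * (d + 2) := by
    rw [← integral_norm_pow_four_stdGaussian d hd, ← hZlaw,
      integral_map hZ.aemeasurable (by fun_prop)]
  calc _ ≤ ∫ ω, 8 * ((d : ℝ) ^ 2 + ‖Z ω‖ ^ 4) / (1 - Real.exp (-t)) ^ 4 ∂P := by
        refine integral_mono_of_nonneg (ae_of_all _ fun ω => by positivity)
          ((((integrable_const _).add hZint).const_mul 8).div_const _) ?_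
        filter_upwards [hsupp] with ω hω
        exact norm_drift_pow_four_le _ hν ht hω (Z ω)
    _ = 8 * ((d : ℝ) ^ 2 + d * (d + 2)) / (1 - Real.exp (-t)) ^ 4 := by
        rw [integral_div, integral_const_mul, integral_add (integrable_const _) hZint, hZ4]
        simp
    _ ≤ _ := by
        have : (0 : ℝ) ≤ d := d.cast_nonneg
        gcongr
        nlinarith
end
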